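/- arXiv:2510.04540 — 5 statements merged into one kernel-verified Lean document; each statement's English description precedes it below -/
import Mathlib

section
/- Derivative bound for the transport solution operator (Lemma 4.1, second part): for every μ∈(−1,0)∪(0,1) and every φ∈L²(Ω;σ_T), the map μ↦A_μφ is differentiable in L²(Ω;σ_T), the derivative satisfies ∂_μ(A_μφ) = −A_μ(μ^{−1}(φ − (σ_T/σ_r)·A_μφ)), and ‖∂_μ(A_μφ)‖ ≤ (1/|μ|)·(1+sup_{x∈Ω}σ_T(x)/σ_r(x))·‖φ‖; in particular ‖∂_μA_μ‖ ≤ (1/|μ|)(1+‖σ_T/σ_r‖_∞) in operator norm. -/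
open MeasureTheory

/-- The measure `σ_T(x) dx` on `Ω = [x_L, x_R]`, so that `Lp ℝ 2` of it is `L²(Ω;σ_T)`. -/
noncomputable def transMeasure (xL xR : ℝ) (σT : ℝ → ℝ) : Measure ℝ :=
  (volume.restrict (Set.Icc xL xR)).withDensity fun x => ENNReal.ofReal (σT x)

/-- The kernel `k_μ(x,y)` of the transport solution operator `A_μ`. -/
noncomputable def transKernel (σT σr : ℝ → ℝ) (μ x y : ℝ) : ℝ :=
  if 0 < μ then
    (if y ≤ x then (1 / μ) * Real.exp (-(1 / μ) * ∫ z in y..x, σT z) * (σr y / σT y) else 0)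
  else
    (if x ≤ y then (-(1 / μ)) * Real.exp ((1 / μ) * ∫ z in x..y, σT z) * (σr y / σT y) else 0)

open Set in
theorem tr_helper {a b c d : ℝ} {F g : ℝ → ℝ} (hac : a ≤ c) (hcd : c ≤ d) (hdb : d ≤ b)
    (hF : ∀ s ∈ Icc a b, F s = if c ≤ s ∧ s ≤ d then g s else 0) :
    ∫ s in Icc a b, F s = ∫ s in c..d, g s := by
  have h1 : ∫ s in Icc a b, F s = ∫ s in Icc a b, (Icc c d).indicator g s := by
    apply setIntegral_congr_fun measurableSet_Icc
    intro s hs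
    simp only [hF s hs, indicator, mem_Icc]
  rw [h1, setIntegral_indicator measurableSet_Icc,
    inter_eq_self_of_subset_right (Icc_subset_Icc hac hdb), integral_Icc_eq_integral_Ioc,
    intervalIntegral.integral_of_le hcd]

/-- convolution kernel -/
noncomputable def trK (h u : ℝ) : ℝ := if 0 ≤ u then h * Real.exp (-h * u) else 0

theorem trK_meas (h : ℝ) : Measurable (trK h) := by
  unfold trK
  exact Measurable.ite measurableSet_Ici (by fun_prop) measurable_const

theorem trK_nonneg {h : ℝ} (hh : 0 ≤ h) (u : ℝ) : 0 ≤ trK h u := by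
  unfold trK; split_ifs <;> positivity

theorem trK_le {h : ℝ} (hh : 0 ≤ h) (u : ℝ) : trK h u ≤ h := by
  unfold trK
  split_ifs with hu
  · have : Real.exp (-h * u) ≤ 1 := Real.exp_le_one_iff.2 (by nlinarith [mul_nonneg hh hu])
    nlinarith
  · exact hh

theorem trK_bdd {h : ℝ} (hh : 0 ≤ h) (u : ℝ) : ‖trK h u‖ ≤ h := by
  rw [Real.norm_eq_abs, abs_of_nonneg (trK_nonneg hh u)]; exact trK_le hh u

open Set in
theorem trK_int1 {a b h x : ℝ} (hx : x ∈ Icc a b) :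
    ∫ s in Icc a b, trK h (x - s) ≤ 1 := by
  rw [tr_helper (c := a) (d := x) (g := fun s => h * Real.exp (-h * (x - s))) le_rfl hx.1 hx.2]
  · rw [intervalIntegral.integral_eq_sub_of_hasDerivAt
      (f := fun s => Real.exp (-h * (x - s)))]
    · have := Real.exp_pos (-h * (x - a))
      simp; positivity
    · intro s _
      have h1 : HasDerivAt (fun s => -h * (x - s)) h s := by
        simpa using ((hasDerivAt_id s).const_sub x).const_mul (-h)
      simpa [mul_comm] using h1.exp
    · exact (by fun_prop : Continuous fun s => h * Real.exp (-h * (x - s))).intervalIntegrable _ _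
  · intro s hs
    simp only [trK, sub_nonneg, hs.1, true_and]

open Set in
theorem trK_int2 {a b h y : ℝ} (hy : y ∈ Icc a b) :
    ∫ s in Icc a b, trK h (s - y) ≤ 1 := by
  rw [tr_helper (c := y) (d := b) (g := fun s => h * Real.exp (-h * (s - y))) hy.1 hy.2 le_rfl]
  · rw [intervalIntegral.integral_eq_sub_of_hasDerivAt
      (f := fun s => -Real.exp (-h * (s - y)))]
    · have := Real.exp_pos (-h * (b - y))
      simp; positivity
    · intro s _
      have h1 : HasDerivAt (fun s => -h * (s - y)) (-h) s := by
        simpa using ((hasDerivAt_id s).sub_const y).const_mul (-h)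
      have h2 := h1.exp.neg
      rw [show -(Real.exp (-h * (s - y)) * -h) = h * Real.exp (-h * (s - y)) by ring] at h2
      exact h2
    · exact (by fun_prop : Continuous fun s => h * Real.exp (-h * (s - y))).intervalIntegrable _ _
  · intro s hs
    simp only [trK, sub_nonneg, hs.2, and_true]

open Set in
theorem trK_comp {a b h x y : ℝ} (hx : x ∈ Icc a b) (hy : y ∈ Icc a b) :
    ∫ s in Icc a b, trK h (x - s) * trK h (s - y) = h * (x - y) * trK h (x - y) := by
  by_cases hxy : y ≤ x
  · rw [tr_helper (c := y) (d := x) (g := fun s => h * h * Real.exp (-h * (x - y))) hy.1 hxy hx.2]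
    · simp [trK, hxy]; ring
    · intro s hs
      simp only [trK, sub_nonneg]
      by_cases h1 : y ≤ s <;> by_cases h2 : s ≤ x <;> simp [h1, h2]
      have : Real.exp (-(h * (x - y))) = Real.exp (-(h * (x - s))) * Real.exp (-(h * (s - y))) := by
        rw [← Real.exp_add]; ring_nf
      rw [this]; ring
  · have : ∀ s ∈ Icc a b, trK h (x - s) * trK h (s - y) = 0 := by
      intro s hs
      simp only [trK, sub_nonneg]
      by_cases h1 : y ≤ s <;> by_cases h2 : s ≤ x <;> simp [h1, h2]
      exact absurd (h1.trans h2) hxy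
    rw [setIntegral_congr_fun measurableSet_Icc this]
    simp [trK, hxy]

theorem trK_taylor {h0 δ d : ℝ} (hh0 : 0 < h0) (hd : 0 ≤ d) (hδ : d * |δ| ≤ 1) (hδ1 : |δ| ≤ 1) :
    |trK (h0 + δ) d - trK h0 d - δ * (h0⁻¹ * (trK h0 d - h0 * d * trK h0 d))|
      ≤ ((h0 + 1) * d ^ 2 + d) * δ ^ 2 := by
  have he : Real.exp (-(h0 + δ) * d) = Real.exp (-h0 * d) * Real.exp (-(d * δ)) := by
    rw [← Real.exp_add]; ring_nf
  have e1 : trK (h0 + δ) d - trK h0 d - δ * (h0⁻¹ * (trK h0 d - h0 * d * trK h0 d))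
      = Real.exp (-h0 * d) * ((h0 + δ) * (Real.exp (-(d * δ)) - 1 - (-(d * δ))) - d * δ ^ 2) := by
    simp only [trK, if_pos hd, he]
    field_simp
    ring
  have e2 : |Real.exp (-(d * δ)) - 1 - (-(d * δ))| ≤ (-(d * δ)) ^ 2 := by
    apply Real.abs_exp_sub_one_sub_id_le
    rw [abs_neg, abs_mul, abs_of_nonneg hd]; exact hδ
  have e3 : Real.exp (-h0 * d) ≤ 1 := Real.exp_le_one_iff.2 (by nlinarith [mul_nonneg hh0.le hd])
  rw [e1, abs_mul, abs_of_pos (Real.exp_pos _)]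
  have e4 : |h0 + δ| ≤ h0 + 1 := by
    calc |h0 + δ| ≤ |h0| + |δ| := abs_add_le _ _
      _ ≤ h0 + 1 := by rw [abs_of_pos hh0]; linarith
  calc Real.exp (-h0 * d) * |(h0 + δ) * (Real.exp (-(d * δ)) - 1 - (-(d * δ))) - d * δ ^ 2|
      ≤ 1 * |(h0 + δ) * (Real.exp (-(d * δ)) - 1 - (-(d * δ))) - d * δ ^ 2| := by gcongr
    _ ≤ |h0 + δ| * |Real.exp (-(d * δ)) - 1 - (-(d * δ))| + d * δ ^ 2 := by
        rw [one_mul, ← abs_mul]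
        refine (abs_sub _ _).trans ?_
        rw [abs_of_nonneg (show 0 ≤ d * δ ^ 2 by positivity)]
    _ ≤ (h0 + 1) * (-(d * δ)) ^ 2 + d * δ ^ 2 := by gcongr
    _ = _ := by ring

section core
variable {a b : ℝ} {m : Measure ℝ} {t : ℝ → ℝ}

theorem tr_transfer (ht : Measurable t) (hmap : m.map t = volume.restrict (Set.Icc a b))
    {F : ℝ → ℝ} (hF : Measurable F) : ∫ z, F (t z) ∂m = ∫ s in Set.Icc a b, F s := by
  rw [← hmap, integral_map ht.aemeasurable hF.aestronglyMeasurable]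

theorem tr_ae (ht : Measurable t) (hmap : m.map t = volume.restrict (Set.Icc a b)) :
    ∀ᵐ z ∂m, t z ∈ Set.Icc a b := by
  have : ∀ᵐ s ∂(m.map t), s ∈ Set.Icc a b := by
    rw [hmap]; exact ae_restrict_mem measurableSet_Icc
  exact ae_of_ae_map ht.aemeasurable this

theorem tr_integrable (ht : Measurable t) {k : ℝ → ℝ} (hk : Measurable k) {C : ℝ}
    (hC : ∀ u, ‖k u‖ ≤ C) (x : ℝ) {g : ℝ → ℝ} (hg : Integrable g m) :
    Integrable (fun y => k (t x - t y) * g y) m := by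
  refine hg.bdd_mul (c := C) ?_ (Filter.Eventually.of_forall fun y => hC _)
  exact (hk.comp (measurable_const.sub ht)).aestronglyMeasurable

theorem tr_integrable2 [IsFiniteMeasure m] (ht : Measurable t) {k : ℝ → ℝ} (hk : Measurable k)
    {C : ℝ} (hC : ∀ u, ‖k u‖ ≤ C) {g : ℝ → ℝ} (hg : Integrable g m) :
    Integrable (Function.uncurry fun x y => k (t x - t y) * g y) (m.prod m) := by
  have h1 : Integrable (fun p : ℝ × ℝ => g p.2) (m.prod m) := hg.comp_snd m
  refine h1.bdd_mul (c := C) ?_ (Filter.Eventually.of_forall fun y => hC _)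
  exact (hk.comp ((ht.comp measurable_fst).sub (ht.comp measurable_snd))).aestronglyMeasurable

theorem tr_memLp_integrable [IsFiniteMeasure m] {r : ℝ → ℝ} (hr : Measurable r)
    (hr1 : ∀ x, |r x| ≤ 1) (φ : Lp ℝ 2 m) : Integrable (fun y => r y * φ y) m := by
  have h1 : Integrable φ m := (Lp.memLp φ).integrable (by norm_num)
  exact h1.bdd_mul (c := 1) hr.aestronglyMeasurable (Filter.Eventually.of_forall hr1)

theorem tr_normsq (φ : Lp ℝ 2 m) : ‖φ‖ ^ 2 = ∫ x, φ x ^ 2 ∂m := by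
  rw [← real_inner_self_eq_norm_sq, L2.inner_def]
  congr 1; ext x; simp [pow_two]

/-- contraction -/
theorem tr_contract [IsFiniteMeasure m] (ht : Measurable t)
    (hmap : m.map t = volume.restrict (Set.Icc a b)) {r : ℝ → ℝ} (hr : Measurable r)
    (hr1 : ∀ x, |r x| ≤ 1) {h : ℝ} (hh : 0 < h) (φ f : Lp ℝ 2 m)
    (hf : ∀ᵐ x ∂m, f x = ∫ y, trK h (t x - t y) * (r y * φ y) ∂m) : ‖f‖ ≤ ‖φ‖ := by
  have hg := tr_memLp_integrable hr hr1 φ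
  set g : ℝ → ℝ := fun y => r y * φ y with hgdef
  have hφ2 : Integrable (fun y => φ y ^ 2) m := (Lp.memLp φ).integrable_sq
  have hg2 : Integrable (fun y => g y ^ 2) m := by
    have : (fun y => g y ^ 2) = fun y => (r y) ^ 2 * φ y ^ 2 := by ext y; simp [hgdef]; ring
    rw [this]
    refine hφ2.bdd_mul (c := 1) (hr.pow_const 2).aestronglyMeasurable
      (Filter.Eventually.of_forall fun y => ?_)
    simpa using (sq_le_one_iff_abs_le_one _).2 (hr1 y)
  have hK := trK_meas h
  have hKb := trK_bdd hh.le
  have hone : Integrable (fun _ : ℝ => (1 : ℝ)) m := integrable_const 1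
  have hpt : ∀ᵐ x ∂m, f x ^ 2 ≤ ∫ y, trK h (t x - t y) * g y ^ 2 ∂m := by
    filter_upwards [hf, tr_ae ht hmap] with x hx htx
    set c := f x
    have i1 := tr_integrable ht hK hKb x hg
    have i2 := tr_integrable ht hK hKb x hg2
    have i0 : Integrable (fun y => trK h (t x - t y)) m := by
      simpa using tr_integrable ht hK hKb x hone
    have hnn : 0 ≤ ∫ y, trK h (t x - t y) * (g y - c) ^ 2 ∂m :=
      integral_nonneg fun y => mul_nonneg (trK_nonneg hh.le _) (sq_nonneg _)
    have heq : ∫ y, trK h (t x - t y) * (g y - c) ^ 2 ∂m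
        = (∫ y, trK h (t x - t y) * g y ^ 2 ∂m) - 2 * c * (∫ y, trK h (t x - t y) * g y ∂m)
          + c ^ 2 * ∫ y, trK h (t x - t y) ∂m := by
      have i3 : Integrable (fun y => trK h (t x - t y) * g y ^ 2
        - 2 * c * (trK h (t x - t y) * g y)) m := i2.sub (i1.const_mul _)
      rw [← integral_const_mul, ← integral_const_mul, ← integral_sub i2 (i1.const_mul _),
        ← integral_add i3 (i0.const_mul _)]
      congr 1; ext y; ring
    have hle : ∫ y, trK h (t x - t y) ∂m ≤ 1 := by
      rw [tr_transfer ht hmap (F := fun s => trK h (t x - s)) (hK.comp (measurable_const.sub measurable_id))]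
      exact trK_int1 htx
    rw [heq, ← hx] at hnn
    nlinarith [sq_nonneg c]
  have i3 := tr_integrable2 ht hK hKb hg2
  have hsq : ‖f‖ ^ 2 ≤ ‖φ‖ ^ 2 := by
    rw [tr_normsq, tr_normsq]
    calc ∫ x, f x ^ 2 ∂m ≤ ∫ x, ∫ y, trK h (t x - t y) * g y ^ 2 ∂m ∂m :=
          integral_mono_ae (Lp.memLp f).integrable_sq i3.integral_prod_left hpt
      _ = ∫ y, ∫ x, trK h (t x - t y) * g y ^ 2 ∂m ∂m := integral_integral_swap i3
      _ ≤ ∫ y, φ y ^ 2 ∂m := by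
          refine integral_mono_ae i3.integral_prod_right hφ2 ?_
          filter_upwards [tr_ae ht hmap] with y hty
          rw [integral_mul_const]
          have hle : ∫ x, trK h (t x - t y) ∂m ≤ 1 := by
            rw [tr_transfer ht hmap (F := fun s => trK h (s - t y)) (hK.comp (measurable_id.sub measurable_const))]
            exact trK_int2 hty
          have h2 : g y ^ 2 ≤ φ y ^ 2 := by
            have := (sq_le_one_iff_abs_le_one _).2 (hr1 y)
            simp only [hgdef, mul_pow]
            nlinarith [sq_nonneg (φ y)]
          nlinarith [sq_nonneg (g y)]
  exact (sq_le_sq₀ (norm_nonneg _) (norm_nonneg _)).1 hsq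

/-- composition -/
theorem tr_comp [IsFiniteMeasure m] (ht : Measurable t)
    (hmap : m.map t = volume.restrict (Set.Icc a b)) {g : ℝ → ℝ} (hg : Integrable g m)
    {h : ℝ} (hh : 0 < h) {f : ℝ → ℝ}
    (hf : ∀ᵐ x ∂m, f x = ∫ y, trK h (t x - t y) * g y ∂m) :
    ∀ᵐ x ∂m, ∫ z, trK h (t x - t z) * f z ∂m
      = ∫ y, h * (t x - t y) * trK h (t x - t y) * g y ∂m := by
  have hK := trK_meas h
  have hKb := trK_bdd hh.le
  filter_upwards [tr_ae ht hmap] with x htx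
  have e1 : ∫ z, trK h (t x - t z) * f z ∂m
      = ∫ z, ∫ y, trK h (t x - t z) * (trK h (t z - t y) * g y) ∂m ∂m := by
    apply integral_congr_ae
    filter_upwards [hf] with z hz
    rw [hz, integral_const_mul]
  have i3 := tr_integrable2 ht hK hKb hg
  have i4 : Integrable (Function.uncurry fun z y =>
      trK h (t x - t z) * (trK h (t z - t y) * g y)) (m.prod m) := by
    refine i3.bdd_mul (c := h) ?_ (Filter.Eventually.of_forall fun p => hKb (t x - t p.1))
    exact (hK.comp (measurable_const.sub (ht.comp measurable_fst))).aestronglyMeasurable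
  rw [e1, integral_integral_swap i4]
  apply integral_congr_ae
  filter_upwards [tr_ae ht hmap] with y hty
  rw [← trK_comp htx hty, ← tr_transfer ht hmap (F := fun s => trK h (t x - s) * trK h (s - t y))
    ((hK.comp (measurable_const.sub measurable_id)).mul (hK.comp (measurable_id.sub measurable_const))),
    ← integral_mul_const]
  congr 1; ext z; ring

/-- remainder bound -/
theorem tr_remainder [IsFiniteMeasure m] (ht : Measurable t) 
    (hmap : m.map t = volume.restrict (Set.Icc a b)) {g : ℝ → ℝ} (hg : Integrable g m)
    {h0 δ : ℝ} (hh0 : 0 < h0) (hδ0 : 0 ≤ h0 + δ) (hab : a ≤ b) (hδ : (b - a) * |δ| ≤ 1)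
    (hδ1 : |δ| ≤ 1) {f0 f1 f2 : Lp ℝ 2 m}
    (hf0 : ∀ᵐ x ∂m, f0 x = ∫ y, trK h0 (t x - t y) * g y ∂m)
    (hf1 : ∀ᵐ x ∂m, f1 x = ∫ y, trK (h0 + δ) (t x - t y) * g y ∂m)
    (hf2 : ∀ᵐ x ∂m, f2 x = ∫ y, h0 * (t x - t y) * trK h0 (t x - t y) * g y ∂m) :
    ‖f1 - f0 - δ • (h0⁻¹ • (f0 - f2))‖ ≤ 
      (measureUnivNNReal m : ℝ) ^ (2 : ENNReal).toReal⁻¹ *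
        (((h0 + 1) * (b - a) ^ 2 + (b - a)) * δ ^ 2 * ∫ y, ‖g y‖ ∂m) := by
  have hba : 0 ≤ b - a := sub_nonneg.2 hab
  refine Lp.norm_le_of_ae_bound ?_ ?_
  · have : 0 ≤ ∫ y, ‖g y‖ ∂m := integral_nonneg fun _ => norm_nonneg _
    positivity
  · filter_upwards [hf0, hf1, hf2, tr_ae ht hmap, Lp.coeFn_sub (f1 - f0) (δ • (h0⁻¹ • (f0 - f2))),
      Lp.coeFn_sub f1 f0, Lp.coeFn_smul δ (h0⁻¹ • (f0 - f2)), Lp.coeFn_smul h0⁻¹ (f0 - f2),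
      Lp.coeFn_sub f0 f2] with x h0x h1x h2x htx c1 c2 c3 c4 c5
    rw [c1, Pi.sub_apply, c2, c3, Pi.smul_apply, c4, Pi.smul_apply, c5, Pi.sub_apply, Pi.sub_apply,
      h0x, h1x, h2x, smul_eq_mul, smul_eq_mul]
    have i0 := tr_integrable ht (trK_meas h0) (trK_bdd hh0.le) x hg
    have i1 := tr_integrable ht (trK_meas (h0 + δ)) (trK_bdd hδ0) x hg
    have i2 : Integrable (fun y => h0 * (t x - t y) * trK h0 (t x - t y) * g y) m := by
      have : (fun y => h0 * (t x - t y) * trK h0 (t x - t y) * g y) =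
        fun y => (h0 * (t x - t y)) * (trK h0 (t x - t y) * g y) := by ext y; ring
      rw [this]
      refine i0.bdd_mul (c := h0 * (b - a)) ?_ ?_
      · exact (measurable_const.mul (measurable_const.sub ht)).aestronglyMeasurable
      · filter_upwards [tr_ae ht hmap] with y hty
        rw [norm_mul, Real.norm_of_nonneg hh0.le]
        gcongr
        rw [Real.norm_eq_abs, abs_le]
        constructor <;> linarith [htx.1, htx.2, hty.1, hty.2]
    have i3 : Integrable (fun y => trK (h0 + δ) (t x - t y) * g y - trK h0 (t x - t y) * g y) m :=
      i1.sub i0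
    have i4 : Integrable (fun y => δ * (h0⁻¹ * (trK h0 (t x - t y) * g y
        - h0 * (t x - t y) * trK h0 (t x - t y) * g y))) m :=
      ((i0.sub i2).const_mul _).const_mul _
    rw [← integral_sub i1 i0, ← integral_sub i0 i2, ← integral_const_mul, ← integral_const_mul,
      ← integral_sub i3 i4, ← integral_const_mul]
    refine norm_integral_le_of_norm_le (hg.norm.const_mul _) ?_
    filter_upwards [tr_ae ht hmap] with y hty
    have e : trK (h0 + δ) (t x - t y) * g y - trK h0 (t x - t y) * g y
        - δ * (h0⁻¹ * (trK h0 (t x - t y) * g y - h0 * (t x - t y) * trK h0 (t x - t y) * g y))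
        = (trK (h0 + δ) (t x - t y) - trK h0 (t x - t y) - δ * (h0⁻¹ * (trK h0 (t x - t y)
          - h0 * (t x - t y) * trK h0 (t x - t y)))) * g y := by ring
    rw [e, norm_mul]
    gcongr
    by_cases hd : 0 ≤ t x - t y
    · have hd2 : t x - t y ≤ b - a := by linarith [htx.1, htx.2, hty.1, hty.2]
      refine (trK_taylor hh0 hd (le_trans (by gcongr) hδ) hδ1).trans ?_
      gcongr
    · simp only [trK, if_neg hd]
      simp
      positivity

open Filter Topology in
/-- derivative -/
theorem tr_deriv [IsFiniteMeasure m] (ht : Measurable t) 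
    (hmap : m.map t = volume.restrict (Set.Icc a b)) (hab : a ≤ b) {g : ℝ → ℝ} (hg : Integrable g m)
    {h0 : ℝ} (hh0 : 0 < h0) {f : ℝ → Lp ℝ 2 m} {f2 : Lp ℝ 2 m}
    (hf : ∀ᶠ h in 𝓝 h0, ∀ᵐ x ∂m, f h x = ∫ y, trK h (t x - t y) * g y ∂m)
    (hf2 : ∀ᵐ x ∂m, f2 x = ∫ y, h0 * (t x - t y) * trK h0 (t x - t y) * g y ∂m) :
    HasDerivAt f (h0⁻¹ • (f h0 - f2)) h0 := by
  rw [hasDerivAt_iff_isLittleO]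
  have hO : (fun h => f h - f h0 - (h - h0) • (h0⁻¹ • (f h0 - f2))) =O[𝓝 h0]
      fun h => (h - h0) ^ 2 := by
    refine Asymptotics.IsBigO.of_bound ((measureUnivNNReal m : ℝ) ^ (2 : ENNReal).toReal⁻¹ *
        (((h0 + 1) * (b - a) ^ 2 + (b - a)) * ∫ y, ‖g y‖ ∂m)) ?_
    have t1 : Tendsto (fun h => (b - a) * |h - h0|) (𝓝 h0) (𝓝 0) := by
      have : Continuous (fun h => (b - a) * |h - h0|) := by fun_prop
      simpa using this.tendsto h0
    have t2 : Tendsto (fun h => |h - h0|) (𝓝 h0) (𝓝 0) := by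
      have : Continuous (fun h => |h - h0|) := by fun_prop
      simpa using this.tendsto h0
    filter_upwards [hf, t1.eventually_le_const one_pos, t2.eventually_le_const one_pos,
      eventually_gt_nhds hh0] with h e1 e2 e3 e4
    have := tr_remainder (δ := h - h0) ht hmap hg hh0 (by linarith) hab e2 e3 hf.self_of_nhds
      (f1 := f h) (by simpa using e1) hf2
    refine this.trans (le_of_eq ?_)
    rw [Real.norm_of_nonneg (sq_nonneg _)]; ring
  refine hO.trans_isLittleO ?_
  have h1 : (fun h : ℝ => (h - h0)) =o[𝓝 h0] fun _ => (1 : ℝ) := by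
    rw [Asymptotics.isLittleO_one_iff]
    have : Continuous (fun h => h - h0) := by fun_prop
    simpa using this.tendsto h0
  have := h1.mul_isBigO (Asymptotics.isBigO_refl (fun h : ℝ => h - h0) (𝓝 h0))
  simpa [pow_two] using this

end core
open Filter Topology in
theorem tr_main {a b : ℝ} {m : Measure ℝ} {t : ℝ → ℝ} [IsFiniteMeasure m] (ht : Measurable t)
    (hmap : m.map t = volume.restrict (Set.Icc a b)) (hab : a ≤ b) {r : ℝ → ℝ} (hr : Measurable r)
    (hr0 : ∀ x, 0 < r x) (hr1 : ∀ x, r x ≤ 1) {ε : ℝ} (hε : ε * ε = 1) {S : ℝ}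
    (hS : ∀ᵐ x ∂m, (r x)⁻¹ ≤ S)
    (A : ℝ → Lp ℝ 2 m →L[ℝ] Lp ℝ 2 m)
    (hA : ∀ ν : ℝ, 0 < ε * ν → ε * ν < 1 → ∀ φ : Lp ℝ 2 m, ∀ᵐ x ∂m,
      A ν φ x = ∫ y, trK (ε / ν) (t x - t y) * (r y * φ y) ∂m)
    (Mop : Lp ℝ 2 m →L[ℝ] Lp ℝ 2 m) (hMop : ∀ f : Lp ℝ 2 m, ∀ᵐ x ∂m, Mop f x = (r x)⁻¹ * f x)
    (μ : ℝ) (hμ0 : 0 < ε * μ) (hμ1 : ε * μ < 1) (hS0 : 0 ≤ S) :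
    ∃ A' : Lp ℝ 2 m →L[ℝ] Lp ℝ 2 m,
        (∀ φ, HasDerivAt (fun ν : ℝ => A ν φ) (A' φ) μ) ∧
        (∀ φ, A' φ = -(A μ (μ⁻¹ • (φ - Mop (A μ φ))))) ∧
        (∀ φ, ‖A' φ‖ ≤ (1 / |μ|) * (1 + S) * ‖φ‖) ∧
        ‖A'‖ ≤ (1 / |μ|) * (1 + S) := by
  have hr1' : ∀ x, |r x| ≤ 1 := fun x => by rw [abs_of_pos (hr0 x)]; exact hr1 x
  have hμne : μ ≠ 0 := by rintro rfl; simp at hμ0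
  have hεne : ε ≠ 0 := by rintro rfl; simp at hε
  have hdiv : ε / μ = (ε * μ)⁻¹ := by
    field_simp; rw [pow_two]; exact hε
  have hh0 : 0 < ε / μ := by rw [hdiv]; positivity
  have hcontr : ∀ φ, ‖A μ φ‖ ≤ ‖φ‖ := fun φ =>
    tr_contract ht hmap hr hr1' hh0 φ _ (hA μ hμ0 hμ1 φ)
  have hM : ∀ f, ‖Mop f‖ ≤ S * ‖f‖ := by
    intro f
    apply Lp.norm_le_mul_norm_of_ae_le_mul
    filter_upwards [hMop f, hS] with x h1 h2
    rw [h1, norm_mul, Real.norm_of_nonneg (inv_pos.2 (hr0 x)).le]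
    gcongr
  let A' : Lp ℝ 2 m →L[ℝ] Lp ℝ 2 m :=
    -((A μ).comp (μ⁻¹ • (ContinuousLinearMap.id ℝ _ - Mop.comp (A μ))))
  have hA' : ∀ φ, A' φ = -(A μ (μ⁻¹ • (φ - Mop (A μ φ)))) := fun φ => by simp [A']
  have hbound : ∀ φ, ‖A' φ‖ ≤ (1 / |μ|) * (1 + S) * ‖φ‖ := by
    intro φ
    rw [hA', norm_neg]
    calc ‖A μ (μ⁻¹ • (φ - Mop (A μ φ)))‖ ≤ ‖μ⁻¹ • (φ - Mop (A μ φ))‖ := hcontr _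
      _ = (1 / |μ|) * ‖φ - Mop (A μ φ)‖ := by rw [norm_smul]; simp
      _ ≤ (1 / |μ|) * (‖φ‖ + S * ‖φ‖) := by
          gcongr
          refine (norm_sub_le _ _).trans ?_
          gcongr
          exact (hM _).trans (by gcongr; exact hcontr φ)
      _ = _ := by ring
  refine ⟨A', ?_, hA', hbound, ContinuousLinearMap.opNorm_le_bound _ (by positivity) hbound⟩
  intro φ
  have hg := tr_memLp_integrable hr hr1' φ
  have hquot : ∀ h : ℝ, ε / (ε / h) = h := fun h => by
    by_cases hh : h = 0
    · simp [hh]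
    · field_simp
  have hd := tr_deriv (f := fun h => A (ε / h) φ) (f2 := A μ (Mop (A μ φ))) ht hmap hab hg hh0 ?_ ?_
  · have hinv : HasDerivAt (fun ν : ℝ => ε / ν) (ε * (-(μ ^ 2)⁻¹)) μ := by
      simpa [div_eq_mul_inv] using (hasDerivAt_inv hμne).const_mul ε
    have hc := HasDerivAt.scomp (𝕜' := ℝ) (g₁ := fun h => A (ε / h) φ) (h := fun ν => ε / ν) μ hd hinv
    have e1 : ((fun h => A (ε / h) φ) ∘ fun ν => ε / ν) = fun ν => A ν φ := by
      ext1 ν; simp [hquot]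
    rw [e1] at hc
    have e2 : A' φ = (ε * (-(μ ^ 2)⁻¹)) •
        ((ε / μ)⁻¹ • (A (ε / (ε / μ)) φ - A μ (Mop (A μ φ)))) := by
      rw [hA', hquot, map_smul, map_sub, smul_smul, ← neg_smul]
      congr 1
      field_simp
    rw [e2]
    exact hc
  · have hc : ContinuousAt (fun h : ℝ => ε * (ε / h)) (ε / μ) :=
      continuousAt_const.mul (continuousAt_const.div continuousAt_id hh0.ne')
    have hv : ε * (ε / (ε / μ)) = ε * μ := by rw [hquot]
    have e1 := hc.eventually (p := fun u => 0 < u) (by simp only [hv]; exact eventually_gt_nhds hμ0)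
    have e2 := hc.eventually (p := fun u => u < 1) (by simp only [hv]; exact eventually_lt_nhds hμ1)
    filter_upwards [e1, e2] with h h1 h2
    simpa only [hquot] using hA (ε / h) h1 h2 φ
  · have c1 := tr_comp ht hmap hg hh0 (hA μ hμ0 hμ1 φ)
    filter_upwards [c1, hA μ hμ0 hμ1 (Mop (A μ φ))] with x h1 h2
    rw [h2, ← h1]
    apply integral_congr_ae
    filter_upwards [hMop (A μ φ)] with z hz
    rw [hz, mul_inv_cancel_left₀ (hr0 z).ne']

theorem tr_map {xL xR : ℝ} {σT t : ℝ → ℝ} {t' : ℝ → ℝ}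
    (ht : ∀ x ∈ Set.Icc xL xR, HasDerivAt t (t' x) x) (hinj : Set.InjOn t (Set.Icc xL xR))
    (htσ : ∀ x ∈ Set.Icc xL xR, |t' x| = σT x) :
    (transMeasure xL xR σT).map t = volume.restrict (t '' Set.Icc xL xR) := by
  rw [← map_withDensity_abs_det_fderiv_eq_addHaar volume measurableSet_Icc.nullMeasurableSet
    (fun x hx => (ht x hx).hasFDerivAt.hasFDerivWithinAt) hinj]
  unfold transMeasure
  congr 1
  apply withDensity_congr_ae
  filter_upwards [ae_restrict_mem measurableSet_Icc] with x hx
  simp [htσ x hx]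

theorem transport_operator_deriv_bound
    (xL xR : ℝ) (hx : xL < xR)
    (σT σr : ℝ → ℝ)
    (hσT : ContinuousOn σT (Set.Icc xL xR)) (hσT_pos : ∀ x ∈ Set.Icc xL xR, 0 < σT x)
    (hσr : ContinuousOn σr (Set.Icc xL xR))
    (hσr_pos : ∀ x ∈ Set.Icc xL xR, 0 < σr x ∧ σr x ≤ σT x)
    (A : ℝ → Lp ℝ 2 (transMeasure xL xR σT) →L[ℝ] Lp ℝ 2 (transMeasure xL xR σT))
    (hA : ∀ μ : ℝ, μ ∈ Set.Icc (-1 : ℝ) 1 → μ ≠ 0 →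
      ∀ φ : Lp ℝ 2 (transMeasure xL xR σT),
        ∀ᵐ x ∂(transMeasure xL xR σT),
          (A μ φ) x = ∫ y in Set.Icc xL xR, transKernel σT σr μ x y * φ y * σT y)
    (Mop : Lp ℝ 2 (transMeasure xL xR σT) →L[ℝ] Lp ℝ 2 (transMeasure xL xR σT))
    (hMop : ∀ f : Lp ℝ 2 (transMeasure xL xR σT),
      ∀ᵐ x ∂(transMeasure xL xR σT), (Mop f) x = (σT x / σr x) * f x) :
    ∀ μ : ℝ, μ ∈ Set.Ioo (-1 : ℝ) 1 → μ ≠ 0 →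
      ∃ A' : Lp ℝ 2 (transMeasure xL xR σT) →L[ℝ] Lp ℝ 2 (transMeasure xL xR σT),
        (∀ φ, HasDerivAt (fun ν : ℝ => A ν φ) (A' φ) μ) ∧
        (∀ φ, A' φ = -(A μ (μ⁻¹ • (φ - Mop (A μ φ))))) ∧
        (∀ φ, ‖A' φ‖ ≤
          (1 / |μ|) * (1 + sSup ((fun x => σT x / σr x) '' Set.Icc xL xR)) * ‖φ‖) ∧
        ‖A'‖ ≤ (1 / |μ|) * (1 + sSup ((fun x => σT x / σr x) '' Set.Icc xL xR)) := by
  intro μ hμ hμne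
  set S := sSup ((fun x => σT x / σr x) '' Set.Icc xL xR) with hSdef
  -- continuous extensions
  let P : ℝ → ℝ := fun x => (Set.projIcc xL xR hx.le x : ℝ)
  have hPc : Continuous P := continuous_subtype_val.comp continuous_projIcc
  have hPm : ∀ x, P x ∈ Set.Icc xL xR := fun x => (Set.projIcc xL xR hx.le x).2
  have hPe : ∀ x ∈ Set.Icc xL xR, P x = x := fun x h => by
    simp only [P]; rw [Set.projIcc_of_mem hx.le h]
  let σ : ℝ → ℝ := fun x => σT (P x)
  have hσc : Continuous σ := hσT.comp_continuous hPc hPm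
  have hσp : ∀ x, 0 < σ x := fun x => hσT_pos _ (hPm x)
  have hσe : ∀ x ∈ Set.Icc xL xR, σ x = σT x := fun x h => by simp only [σ, hPe x h]
  let r : ℝ → ℝ := fun x => σr (P x) / σT (P x)
  have hrc : Continuous r := (hσr.comp_continuous hPc hPm).div hσc fun x => (hσp x).ne'
  have hr0 : ∀ x, 0 < r x := fun x => div_pos (hσr_pos _ (hPm x)).1 (hσp x)
  have hr1 : ∀ x, r x ≤ 1 := fun x => (div_le_one (hσp x)).2 (hσr_pos _ (hPm x)).2
  have hre : ∀ x ∈ Set.Icc xL xR, r x = σr x / σT x := fun x h => by simp only [r, hPe x h]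
  -- optical depth
  let τ : ℝ → ℝ := fun x => ∫ z in xL..x, σ z
  have hτd : ∀ x, HasDerivAt τ (σ x) x := fun x =>
    (hσc.integral_hasStrictDerivAt xL x).hasDerivAt
  have hτc : Continuous τ := continuous_iff_continuousAt.2 fun x => (hτd x).continuousAt
  have hτm : StrictMono τ := strictMono_of_hasDerivAt_pos hτd hσp
  have hint : ∀ x ∈ Set.Icc xL xR, ∀ y ∈ Set.Icc xL xR, ∫ z in y..x, σT z = τ x - τ y := by
    intro x hx' y hy'
    simp only [τ]
    rw [intervalIntegral.integral_interval_sub_left (hσc.intervalIntegrable _ _)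
      (hσc.intervalIntegrable _ _)]
    apply intervalIntegral.integral_congr
    intro z hz
    exact (hσe z (Set.uIcc_subset_Icc hy' hx' hz)).symm
  have himg : τ '' Set.Icc xL xR = Set.Icc (τ xL) (τ xR) := by
    apply Set.Subset.antisymm
    · rintro _ ⟨x, h, rfl⟩
      exact ⟨hτm.monotone h.1, hτm.monotone h.2⟩
    · exact intermediate_value_Icc hx.le hτc.continuousOn
  have hmapτ : (transMeasure xL xR σT).map τ = volume.restrict (Set.Icc (τ xL) (τ xR)) := by
    rw [← himg]
    exact tr_map (fun x _ => hτd x) hτm.injective.injOn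
      fun x h => by rw [abs_of_pos (hσp x), hσe x h]
  have hmapn : (transMeasure xL xR σT).map (fun x => -τ x) = volume.restrict (Set.Icc (-τ xR) (-τ xL)) := by
    have : (fun x => -τ x) '' Set.Icc xL xR = Set.Icc (-τ xR) (-τ xL) := by
      rw [← Set.image_image (fun x => -x) τ, himg]; simp
    rw [← this]
    exact tr_map (t' := fun x => -σ x) (fun x _ => (hτd x).neg)
      (fun x _ y _ h => hτm.injective (neg_injective h))
      fun x h => by rw [abs_neg, abs_of_pos (hσp x), hσe x h]
  have hfin : IsFiniteMeasure (transMeasure xL xR σT) := by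
    constructor
    have h1 : (transMeasure xL xR σT).map τ Set.univ < ⊤ := by
      rw [hmapτ]; exact measure_lt_top _ _
    rwa [Measure.map_apply hτc.measurable MeasurableSet.univ, Set.preimage_univ] at h1
  have hmae : ∀ᵐ x ∂(transMeasure xL xR σT), x ∈ Set.Icc xL xR :=
    (withDensity_absolutelyContinuous _ _).ae_le (ae_restrict_mem measurableSet_Icc)
  have hSup : ∀ x ∈ Set.Icc xL xR, σT x / σr x ≤ S := by
    intro x h
    refine le_csSup ?_ (Set.mem_image_of_mem _ h)
    exact (isCompact_Icc.image_of_continuousOn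
      (hσT.div hσr fun x h => (hσr_pos x h).1.ne')).bddAbove
  have hS : ∀ᵐ x ∂(transMeasure xL xR σT), (r x)⁻¹ ≤ S := by
    filter_upwards [hmae] with x h
    rw [hre x h, inv_div]; exact hSup x h
  have hS0 : 0 ≤ S := by
    have h : xL ∈ Set.Icc xL xR := ⟨le_rfl, hx.le⟩
    exact (div_pos (hσT_pos _ h) (hσr_pos _ h).1).le.trans (hSup _ h)
  have hMop' : ∀ f : Lp ℝ 2 (transMeasure xL xR σT), ∀ᵐ x ∂(transMeasure xL xR σT), Mop f x = (r x)⁻¹ * f x := by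
    intro f
    filter_upwards [hmae, hMop f] with x h h1
    rw [h1, hre x h, inv_div]
  have hdens : ∀ F : ℝ → ℝ, ∫ y, F y ∂(transMeasure xL xR σT) = ∫ y in Set.Icc xL xR, F y * σT y := by
    intro F
    rw [transMeasure, integral_withDensity_eq_integral_toReal_smul₀
      (hσT.aemeasurable measurableSet_Icc).ennreal_ofReal
      (Filter.Eventually.of_forall fun x => ENNReal.ofReal_lt_top)]
    apply setIntegral_congr_fun measurableSet_Icc
    intro y hy
    simp only [smul_eq_mul]
    rw [ENNReal.toReal_ofReal (hσT_pos y hy).le, mul_comm]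
  rcases lt_or_gt_of_ne hμne with hneg | hpos
  · refine tr_main (t := fun x => -τ x) (ε := -1) (r := r) hτc.neg.measurable hmapn
      (neg_le_neg (hτm.monotone hx.le)) hrc.measurable hr0 hr1 (by norm_num) hS A ?_ Mop hMop' μ
      (by linarith) (by linarith [hμ.1]) hS0
    intro ν hν0 hν1 φ
    filter_upwards [hmae, hA ν ⟨by linarith, by linarith⟩ (by rintro rfl; simp at hν0) φ] with x hx' h
    rw [h, hdens]
    apply setIntegral_congr_fun measurableSet_Icc
    intro y hy
    simp only
    rw [transKernel, if_neg (by linarith), trK, hint y hy x hx', hre y hy]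
    by_cases hxy : x ≤ y
    · rw [if_pos hxy, if_pos (by linarith [hτm.monotone hxy])]
      ring_nf
    · rw [if_neg hxy, if_neg (by linarith [hτm (not_le.1 hxy)])]
      ring
  · refine tr_main (t := τ) (ε := 1) (r := r) hτc.measurable hmapτ
      (hτm.monotone hx.le) hrc.measurable hr0 hr1 (by norm_num) hS A ?_ Mop hMop' μ
      (by linarith) (by linarith [hμ.2]) hS0
    intro ν hν0 hν1 φ
    filter_upwards [hmae, hA ν ⟨by linarith, by linarith⟩ (by rintro rfl; simp at hν0) φ] with x hx' h
    rw [h, hdens]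
    apply setIntegral_congr_fun measurableSet_Icc
    intro y hy
    simp only
    rw [transKernel, if_pos (by linarith), trK, hint x hx' y hy, hre y hy]
    by_cases hxy : y ≤ x
    · rw [if_pos hxy, if_pos (by linarith [hτm.monotone hxy])]
      ring_nf
    · rw [if_neg hxy, if_neg (by linarith [hτm (not_le.1 hxy)])]
      ring
end

section
/- Uniform smallness of the cellwise ROM fluctuation operators (Lemma 4.1, third part): there exists a constant C>0, depending only on σ_T, σ_r and the uniform bound on the rescaled weights α_ℓ (not on n, ℓ, δ, or the sample ξ), such that for every even n=2m, every ℓ∈{1,…,m} and every realization ξ of the random ordinates, the operator norms satisfy ‖δT_ℓ^ξ‖ ≤ (C/δ)·n^{−1}, and consequently sup_ξ‖δT^ξ‖ ≤ (C/δ)·n^{−1}. -/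
open MeasureTheory

namespace ROM

open scoped ENNReal

lemma schur_pt {α : Type*} [MeasurableSpace α] (m : Measure α) (g f : α → ℝ≥0∞)
    (hg : AEMeasurable g m) (hf : AEMeasurable f m) :
    (∫⁻ y, g y * f y ∂m) ^ 2 ≤ (∫⁻ y, g y ∂m) * ∫⁻ y, g y * f y ^ 2 ∂m := by
  have h := ENNReal.lintegral_mul_le_Lp_mul_Lq m (p := 2) (q := 2)
    Real.HolderConjugate.two_two
    (f := fun y => g y ^ (1/2 : ℝ)) (g := fun y => g y ^ (1/2 : ℝ) * f y)
    (hg.pow_const _) ((hg.pow_const _).mul hf)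
  have hs : ∀ a : ℝ≥0∞, a ^ (1/2 : ℝ) * a ^ (1/2 : ℝ) = a := by
    intro a
    rw [← ENNReal.rpow_add_of_nonneg _ _ (by norm_num) (by norm_num)]
    norm_num
  have hs2 : ∀ a : ℝ≥0∞, (a ^ (1/2 : ℝ)) ^ (2:ℝ) = a := by
    intro a
    rw [← ENNReal.rpow_mul]; norm_num
  have e1 : ∀ y, ((fun y => g y ^ (1/2 : ℝ)) * (fun y => g y ^ (1/2 : ℝ) * f y)) y = g y * f y := by
    intro y
    simp only [Pi.mul_apply]
    rw [← mul_assoc, hs]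
  have e3 : ∀ y, (g y ^ (1/2 : ℝ) * f y) ^ (2:ℝ) = g y * f y ^ 2 := by
    intro y
    rw [ENNReal.mul_rpow_of_nonneg _ _ (by norm_num), hs2]
    norm_num
  simp only [e1, hs2, e3] at h
  calc _ ≤ ((∫⁻ y, g y ∂m) ^ (1/2 : ℝ) * (∫⁻ y, g y * f y ^ 2 ∂m) ^ (1/2 : ℝ)) ^ 2 := by gcongr
    _ = _ := by rw [mul_pow, sq, sq, hs, hs]

lemma schur {α : Type*} [MeasurableSpace α] (m : Measure α) [SFinite m] (h : α → α → ℝ≥0∞)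
    (hh : Measurable (Function.uncurry h)) (c : ℝ≥0∞)
    (h1 : ∀ᵐ x ∂m, ∫⁻ y, h x y ∂m ≤ c) (h2 : ∀ᵐ y ∂m, ∫⁻ x, h x y ∂m ≤ c)
    (f : α → ℝ≥0∞) (hf : AEMeasurable f m) :
    ∫⁻ x, (∫⁻ y, h x y * f y ∂m) ^ 2 ∂m ≤ c ^ 2 * ∫⁻ y, f y ^ 2 ∂m := by
  wlog hfm : Measurable f generalizing f with H
  · have := H _ hf.measurable_mk.aemeasurable hf.measurable_mk
    have e := hf.ae_eq_mk
    calc _ = ∫⁻ x, (∫⁻ y, h x y * hf.mk f y ∂m) ^ 2 ∂m := by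
            congr 1; ext x; congr 1
            apply lintegral_congr_ae
            filter_upwards [e] with y hy
            rw [hy]
      _ ≤ _ := this
      _ = _ := by
            congr 1
            apply lintegral_congr_ae
            filter_upwards [e] with y hy
            rw [hy]
  have hx : ∀ x, Measurable (h x) := fun x => hh.comp measurable_prodMk_left
  have hy : ∀ y, Measurable (fun x => h x y) := fun y => hh.comp measurable_prodMk_right
  calc ∫⁻ x, (∫⁻ y, h x y * f y ∂m) ^ 2 ∂m
      ≤ ∫⁻ x, c * ∫⁻ y, h x y * f y ^ 2 ∂m ∂m := by
        apply lintegral_mono_ae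
        filter_upwards [h1] with x hx1
        refine (schur_pt m (h x) f (hx x).aemeasurable hf).trans ?_
        gcongr
    _ = c * ∫⁻ x, ∫⁻ y, h x y * f y ^ 2 ∂m ∂m := by
        apply lintegral_const_mul
        apply Measurable.lintegral_prod_right (f := fun x y => h x y * f y ^ 2)
        exact hh.mul ((hfm.comp measurable_snd).pow_const 2)
    _ = c * ∫⁻ y, ∫⁻ x, h x y * f y ^ 2 ∂m ∂m := by
        rw [lintegral_lintegral_swap]
        exact (hh.mul ((hfm.comp measurable_snd).pow_const 2)).aemeasurable
    _ ≤ c * ∫⁻ y, c * f y ^ 2 ∂m := by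
        gcongr 1
        apply lintegral_mono_ae
        filter_upwards [h2] with y hy2
        rw [lintegral_mul_const _ (hy y)]
        gcongr
    _ = _ := by
        rw [lintegral_const_mul _ (hfm.pow_const 2), ← mul_assoc, sq c]

lemma opnorm_schur {α : Type*} [MeasurableSpace α] (m : Measure α) [SFinite m]
    (B : Lp ℝ 2 m →L[ℝ] Lp ℝ 2 m) (h : α → α → ℝ≥0∞)
    (hh : Measurable (Function.uncurry h)) (c : ℝ) (hc : 0 ≤ c)
    (h1 : ∀ᵐ x ∂m, ∫⁻ y, h x y ∂m ≤ ENNReal.ofReal c)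
    (h2 : ∀ᵐ y ∂m, ∫⁻ x, h x y ∂m ≤ ENNReal.ofReal c)
    (hB : ∀ φ : Lp ℝ 2 m, ∀ᵐ x ∂m, ‖(B φ) x‖ₑ ≤ ∫⁻ y, h x y * ‖φ y‖ₑ ∂m) :
    ‖B‖ ≤ c := by
  refine B.opNorm_le_bound hc fun φ => ?_
  have key : ‖B φ‖ₑ ^ 2 ≤ (ENNReal.ofReal c * ‖φ‖ₑ) ^ 2 := by
    have hn : ∀ ψ : Lp ℝ 2 m, ‖ψ‖ₑ ^ 2 = ∫⁻ x, ‖ψ x‖ₑ ^ 2 ∂m := by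
      intro ψ
      rw [Lp.enorm_def, eLpNorm_eq_lintegral_rpow_enorm_toReal (by norm_num) (by norm_num)]
      simp only [ENNReal.toReal_ofNat, ENNReal.rpow_ofNat]
      rw [← ENNReal.rpow_ofNat, ← ENNReal.rpow_mul]
      norm_num
    rw [mul_pow, hn, hn]
    refine le_trans ?_ (schur m h hh _ h1 h2 (fun y => ‖φ y‖ₑ)
      (Lp.aestronglyMeasurable φ).enorm)
    apply lintegral_mono_ae
    filter_upwards [hB φ] with x hx
    gcongr
  have k2 : ‖B φ‖ₑ ≤ ENNReal.ofReal c * ‖φ‖ₑ := by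
    by_contra hlt
    exact absurd key (not_le.2 (ENNReal.pow_lt_pow_left (by norm_num) (not_le.1 hlt)))
  rw [← ofReal_norm, ← ofReal_norm, ← ENNReal.ofReal_mul hc] at k2
  exact (ENNReal.ofReal_le_ofReal_iff (by positivity)).1 k2

/-- majorant of `|G_μ - G_ν|` for `ν ≤ μ`. -/
noncomputable def HH (ν μ t : ℝ) : ℝ :=
  (1/ν) * (Real.exp (-(1/μ) * t) - Real.exp (-(1/ν) * t)) + (1/ν - 1/μ) * Real.exp (-(1/μ) * t)

/-- antiderivative of `HH`. -/
noncomputable def PP (ν μ t : ℝ) : ℝ :=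
  - (2 * μ / ν - 1) * Real.exp (-(1/μ) * t) + Real.exp (-(1/ν) * t)

lemma PP_deriv {ν μ : ℝ} (hν : 0 < ν) (hμ : ν ≤ μ) (t : ℝ) :
    HasDerivAt (PP ν μ) (HH ν μ t) t := by
  have hm : 0 < μ := hν.trans_le hμ
  have e : ∀ a : ℝ, HasDerivAt (fun t => Real.exp (a * t)) (Real.exp (a * t) * a) t := by
    intro a
    have := ((hasDerivAt_id t).const_mul a).exp
    simpa using this
  have := ((e (-(1/μ))).const_mul (- (2 * μ / ν - 1))).add (e (-(1/ν)))
  refine this.congr_deriv ?_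
  unfold HH
  field_simp
  ring

lemma exp_cmp {ν μ : ℝ} (hν : 0 < ν) (hμ : ν ≤ μ) {t : ℝ} (ht : 0 ≤ t) :
    Real.exp (-(1/ν) * t) ≤ Real.exp (-(1/μ) * t) := by
  have : 1/μ ≤ 1/ν := one_div_le_one_div_of_le hν hμ
  apply Real.exp_le_exp.2
  nlinarith

lemma PP_nonpos {ν μ : ℝ} (hν : 0 < ν) (hμ : ν ≤ μ) {t : ℝ} (ht : 0 ≤ t) :
    PP ν μ t ≤ 0 := by
  have h := exp_cmp hν hμ ht
  have : 1 ≤ μ / ν := (one_le_div hν).2 hμ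
  have h3 : 2 * μ / ν = 2 * (μ / ν) := by ring
  unfold PP
  rw [h3]
  have := Real.exp_pos (-(1/μ) * t)
  nlinarith

lemma PP_zero {ν μ : ℝ} (hν : 0 < ν) : PP ν μ 0 = - (2 * (μ - ν) / ν) := by
  unfold PP
  simp
  field_simp
  ring

lemma HH_nonneg {ν μ : ℝ} (hν : 0 < ν) (hμ : ν ≤ μ) {t : ℝ} (ht : 0 ≤ t) :
    0 ≤ HH ν μ t := by
  have h := exp_cmp hν hμ ht
  have h1 : 1/μ ≤ 1/ν := one_div_le_one_div_of_le hν hμ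
  have h2 : 0 < 1/ν := by positivity
  unfold HH
  have := Real.exp_pos (-(1/μ) * t)
  have a1 := mul_nonneg h2.le (sub_nonneg.2 h)
  have a2 := mul_nonneg (sub_nonneg.2 h1) this.le
  linarith

lemma HH_bound {ν μ : ℝ} (hν : 0 < ν) (hμ : ν ≤ μ) {t : ℝ} (ht : 0 ≤ t) :
    |(1/μ) * Real.exp (-(1/μ) * t) - (1/ν) * Real.exp (-(1/ν) * t)| ≤ HH ν μ t := by
  have h := exp_cmp hν hμ ht
  have h1 : 1/μ ≤ 1/ν := one_div_le_one_div_of_le hν hμ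
  have h2 : 0 < 1/ν := by positivity
  unfold HH
  have := Real.exp_pos (-(1/μ) * t)
  have a1 := mul_nonneg h2.le (sub_nonneg.2 h)
  have a2 := mul_nonneg (sub_nonneg.2 h1) this.le
  rw [abs_le]
  constructor <;> nlinarith

lemma HH_cont (ν μ : ℝ) : Continuous (HH ν μ) := by
  unfold HH; fun_prop

/-- Schur majorant. -/
noncomputable def hk (ν μ : ℝ) (τ : ℝ → ℝ) (x y : ℝ) : ℝ≥0∞ :=
  if y ≤ x then ENNReal.ofReal (HH ν μ (τ x - τ y)) else 0

lemma hk_meas (ν μ : ℝ) {τ : ℝ → ℝ} (hτ : Continuous τ) :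
    Measurable (Function.uncurry (hk ν μ τ)) := by
  unfold hk
  apply Measurable.ite (measurableSet_le measurable_snd measurable_fst) _ measurable_const
  apply ENNReal.measurable_ofReal.comp
  apply Continuous.measurable
  exact (HH_cont ν μ).comp ((hτ.comp continuous_fst).sub (hτ.comp continuous_snd))

lemma tau_mono {σ τ : ℝ → ℝ} (hpos : ∀ x, 0 < σ x)
    (hτ : ∀ x, HasDerivAt τ (σ x) x) : Monotone τ :=
  monotone_of_deriv_nonneg (fun x => (hτ x).differentiableAt)
    (fun x => by rw [(hτ x).deriv]; exact (hpos x).le)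

lemma hk_row {ν μ : ℝ} (hν : 0 < ν) (hμ : ν ≤ μ) {σ τ : ℝ → ℝ} (hσ : Continuous σ)
    (hpos : ∀ x, 0 < σ x) (hτ : ∀ x, HasDerivAt τ (σ x) x) (xL xR x : ℝ)
    (hx : x ∈ Set.Icc xL xR) :
    ∫⁻ y, hk ν μ τ x y ∂((volume.restrict (Set.Icc xL xR)).withDensity
      fun x => ENNReal.ofReal (σ x)) ≤ ENNReal.ofReal (2 * (μ - ν) / ν) := by
  have hmono := tau_mono hpos hτ
  have hτc : Continuous τ := continuous_iff_continuousAt.2 fun x => (hτ x).continuousAt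
  have hmeas : Measurable (hk ν μ τ x) := (hk_meas ν μ hτc).comp measurable_prodMk_left
  rw [lintegral_withDensity_eq_lintegral_mul _ (by fun_prop) hmeas]
  have e : ∀ y, ((fun x => ENNReal.ofReal (σ x)) * hk ν μ τ x) y
      = (Set.Iic x).indicator (fun y => ENNReal.ofReal (HH ν μ (τ x - τ y) * σ y)) y := by
    intro y
    by_cases h : y ≤ x
    · have := HH_nonneg hν hμ (sub_nonneg.2 (hmono h))
      simp only [hk, Pi.mul_apply, if_pos h, Set.indicator, Set.mem_Iic]
      rw [ENNReal.ofReal_mul this, mul_comm]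
    · simp [hk, h, Set.indicator]
  simp_rw [e]
  rw [lintegral_indicator measurableSet_Iic, Measure.restrict_restrict measurableSet_Iic]
  have es : Set.Iic x ∩ Set.Icc xL xR = Set.Icc xL x := by
    ext z; simp only [Set.mem_inter_iff, Set.mem_Iic, Set.mem_Icc]
    constructor
    · rintro ⟨a, b, c⟩; exact ⟨b, a⟩
    · rintro ⟨a, b⟩; exact ⟨b, a, b.trans hx.2⟩
  rw [es]
  have hc : Continuous fun y => HH ν μ (τ x - τ y) * σ y :=
    ((HH_cont ν μ).comp (continuous_const.sub hτc)).mul hσ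
  rw [← ofReal_integral_eq_lintegral_ofReal]
  · apply ENNReal.ofReal_le_ofReal
    rw [integral_Icc_eq_integral_Ioc, ← intervalIntegral.integral_of_le hx.1]
    rw [intervalIntegral.integral_eq_sub_of_hasDerivAt (f := fun y => - PP ν μ (τ x - τ y))]
    · have := PP_nonpos hν hμ (sub_nonneg.2 (hmono hx.1))
      simp only [sub_self, PP_zero hν]
      linarith
    · intro y _
      have := ((PP_deriv hν hμ (τ x - τ y)).comp y ((hτ y).const_sub (τ x))).neg
      refine this.congr_deriv ?_
      ring
    · exact hc.intervalIntegrable _ _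
  · exact hc.integrableOn_Icc
  · filter_upwards [ae_restrict_mem measurableSet_Icc] with y hy
    exact mul_nonneg (HH_nonneg hν hμ (sub_nonneg.2 (hmono hy.2))) (hpos y).le

lemma hk_col {ν μ : ℝ} (hν : 0 < ν) (hμ : ν ≤ μ) {σ τ : ℝ → ℝ} (hσ : Continuous σ)
    (hpos : ∀ x, 0 < σ x) (hτ : ∀ x, HasDerivAt τ (σ x) x) (xL xR y : ℝ)
    (hx : y ∈ Set.Icc xL xR) :
    ∫⁻ x, hk ν μ τ x y ∂((volume.restrict (Set.Icc xL xR)).withDensity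
      fun x => ENNReal.ofReal (σ x)) ≤ ENNReal.ofReal (2 * (μ - ν) / ν) := by
  have hmono := tau_mono hpos hτ
  have hτc : Continuous τ := continuous_iff_continuousAt.2 fun x => (hτ x).continuousAt
  have hmeas : Measurable (fun x => hk ν μ τ x y) :=
    (hk_meas ν μ hτc).comp measurable_prodMk_right
  rw [lintegral_withDensity_eq_lintegral_mul _ (by fun_prop) hmeas]
  have e : ∀ x, ((fun x => ENNReal.ofReal (σ x)) * fun x => hk ν μ τ x y) x
      = (Set.Ici y).indicator (fun x => ENNReal.ofReal (HH ν μ (τ x - τ y) * σ x)) x := by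
    intro x
    by_cases h : y ≤ x
    · have := HH_nonneg hν hμ (sub_nonneg.2 (hmono h))
      simp only [hk, Pi.mul_apply, if_pos h, Set.indicator, Set.mem_Ici]
      rw [ENNReal.ofReal_mul this, mul_comm]
    · simp [hk, h, Set.indicator]
  simp_rw [e]
  rw [lintegral_indicator measurableSet_Ici, Measure.restrict_restrict measurableSet_Ici]
  have es : Set.Ici y ∩ Set.Icc xL xR = Set.Icc y xR := by
    ext z; simp only [Set.mem_inter_iff, Set.mem_Ici, Set.mem_Icc]
    constructor
    · rintro ⟨a, b, c⟩; exact ⟨a, c⟩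
    · rintro ⟨a, b⟩; exact ⟨a, hx.1.trans a, b⟩
  rw [es]
  have hc : Continuous fun x => HH ν μ (τ x - τ y) * σ x :=
    ((HH_cont ν μ).comp (hτc.sub continuous_const)).mul hσ
  rw [← ofReal_integral_eq_lintegral_ofReal]
  · apply ENNReal.ofReal_le_ofReal
    rw [integral_Icc_eq_integral_Ioc, ← intervalIntegral.integral_of_le hx.2]
    rw [intervalIntegral.integral_eq_sub_of_hasDerivAt (f := fun x => PP ν μ (τ x - τ y))]
    · have := PP_nonpos hν hμ (sub_nonneg.2 (hmono hx.2))
      simp only [sub_self, PP_zero hν]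
      linarith
    · intro x _
      exact (PP_deriv hν hμ (τ x - τ y)).comp x ((hτ x).sub_const (τ y))
    · exact hc.intervalIntegrable _ _
  · exact hc.integrableOn_Icc
  · filter_upwards [ae_restrict_mem measurableSet_Icc] with x hy
    exact mul_nonneg (HH_nonneg hν hμ (sub_nonneg.2 (hmono hy.1))) (hpos x).le

lemma diff_bound (xL xR : ℝ) (σ σT : ℝ → ℝ) (hσ : Continuous σ) (hpos : ∀ x, 0 < σ x)
    (heq : ∀ x ∈ Set.Icc xL xR, σT x = σ x) (m : Measure ℝ)
    (hm : m = (volume.restrict (Set.Icc xL xR)).withDensity fun x => ENNReal.ofReal (σ x))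
    (A1 A2 : Lp ℝ 2 m →L[ℝ] Lp ℝ 2 m) (k1 k2 : ℝ → ℝ → ℝ)
    (hA1 : ∀ φ : Lp ℝ 2 m, ∀ᵐ x ∂m, (A1 φ) x = ∫ y in Set.Icc xL xR, k1 x y * φ y * σT y)
    (hA2 : ∀ φ : Lp ℝ 2 m, ∀ᵐ x ∂m, (A2 φ) x = ∫ y in Set.Icc xL xR, k2 x y * φ y * σT y)
    (hk1 : ∀ x ∈ Set.Icc xL xR,
      AEStronglyMeasurable (k1 x) (volume.restrict (Set.Icc xL xR)))
    (hk2 : ∀ x ∈ Set.Icc xL xR,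
      AEStronglyMeasurable (k2 x) (volume.restrict (Set.Icc xL xR)))
    (M : ℝ) (hb1 : ∀ x ∈ Set.Icc xL xR, ∀ y ∈ Set.Icc xL xR, |k1 x y| ≤ M)
    (hb2 : ∀ x ∈ Set.Icc xL xR, ∀ y ∈ Set.Icc xL xR, |k2 x y| ≤ M)
    (h : ℝ → ℝ → ℝ≥0∞) (hh : Measurable (Function.uncurry h))
    (hd : ∀ x ∈ Set.Icc xL xR, ∀ y ∈ Set.Icc xL xR, ‖k1 x y - k2 x y‖ₑ ≤ h x y)
    (c : ℝ) (hc : 0 ≤ c)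
    (h1 : ∀ x ∈ Set.Icc xL xR, ∫⁻ y, h x y ∂m ≤ ENNReal.ofReal c)
    (h2 : ∀ y ∈ Set.Icc xL xR, ∫⁻ x, h x y ∂m ≤ ENNReal.ofReal c) :
    ‖A1 - A2‖ ≤ c := by
  have hfd : ∫⁻ x in Set.Icc xL xR, ENNReal.ofReal (σ x) ≠ ∞ := by
    have hi : Integrable σ (volume.restrict (Set.Icc xL xR)) := hσ.integrableOn_Icc
    rw [← ofReal_integral_eq_lintegral_ofReal hi (ae_of_all _ fun x => (hpos x).le)]
    exact ENNReal.ofReal_ne_top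
  have : IsFiniteMeasure m := by
    rw [hm]; exact isFiniteMeasure_withDensity hfd
  have hmeas : Measurable fun x => ENNReal.ofReal (σ x) := by fun_prop
  have hae : ∀ᵐ x ∂m, x ∈ Set.Icc xL xR := by
    have : m ≪ volume.restrict (Set.Icc xL xR) := by
      rw [hm]; exact withDensity_absolutelyContinuous _ _
    exact this.ae_le (ae_restrict_mem measurableSet_Icc)
  refine opnorm_schur m (A1 - A2) h hh c hc ?_ ?_ ?_
  · filter_upwards [hae] with x hx using h1 x hx
  · filter_upwards [hae] with x hx using h2 x hx
  intro φ
  have hφ : Integrable φ m := (Lp.memLp φ).integrable (by norm_num)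
  have hφ2 : Integrable (fun y => φ y * σT y) (volume.restrict (Set.Icc xL xR)) := by
    have hφ' := hφ
    generalize (φ : ℝ → ℝ) = g at hφ' ⊢
    rw [hm, integrable_withDensity_iff_integrable_smul' hmeas (by simp)] at hφ'
    refine hφ'.congr ?_
    filter_upwards [ae_restrict_mem measurableSet_Icc] with y hy
    rw [heq y hy, ENNReal.toReal_ofReal (hpos y).le, smul_eq_mul, mul_comm]
  have hint : ∀ k : ℝ → ℝ, AEStronglyMeasurable k (volume.restrict (Set.Icc xL xR)) →
      (∀ y ∈ Set.Icc xL xR, |k y| ≤ M) →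
      Integrable (fun y => k y * φ y * σT y) (volume.restrict (Set.Icc xL xR)) := by
    intro k hk hb
    simp_rw [mul_assoc]
    refine hφ2.bdd_mul (c := M) hk ?_
    filter_upwards [ae_restrict_mem measurableSet_Icc] with y hy using hb y hy
  have hsub : ∀ᵐ x ∂m, ((A1 - A2) φ) x = (A1 φ) x - (A2 φ) x := by
    rw [_root_.sub_apply]
    exact Lp.coeFn_sub _ _
  filter_upwards [hae, hA1 φ, hA2 φ, hsub] with x hx e1 e2 e3
  rw [e3, e1, e2, ← integral_sub (hint _ (hk1 x hx) (hb1 x hx)) (hint _ (hk2 x hx) (hb2 x hx))]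
  refine (enorm_integral_le_lintegral_enorm _).trans ?_
  have hhx : Measurable (h x) := hh.comp measurable_prodMk_left
  have hr : ∫⁻ y, h x y * ‖φ y‖ₑ ∂m
      = ∫⁻ y in Set.Icc xL xR, ENNReal.ofReal (σ y) * (h x y * ‖φ y‖ₑ) := by
    have aem : AEMeasurable (fun y => h x y * ‖φ y‖ₑ) m :=
      hhx.aemeasurable.mul (Lp.aestronglyMeasurable φ).enorm
    have := lintegral_withDensity_eq_lintegral_mul₀' (μ := volume.restrict (Set.Icc xL xR))
      hmeas.aemeasurable (g := fun y => h x y * ‖φ y‖ₑ) (by rw [← hm]; exact aem)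
    rw [← hm] at this
    simpa using this
  rw [hr]
  apply lintegral_mono_ae
  filter_upwards [ae_restrict_mem measurableSet_Icc] with y hy
  have : k1 x y * φ y * σT y - k2 x y * φ y * σT y = σ y * ((k1 x y - k2 x y) * φ y) := by
    rw [heq y hy]; ring
  rw [this, enorm_mul, enorm_mul, Real.enorm_of_nonneg (hpos y).le]
  gcongr
  exact hd x hx y hy

lemma lip_pos (xL xR : ℝ) (σ σT σr τ : ℝ → ℝ) (hσ : Continuous σ) (hpos : ∀ x, 0 < σ x)
    (heq : ∀ x ∈ Set.Icc xL xR, σT x = σ x)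
    (hσr : ContinuousOn σr (Set.Icc xL xR))
    (hσr_pos : ∀ x ∈ Set.Icc xL xR, 0 < σr x ∧ σr x ≤ σT x)
    (hτ : ∀ x, HasDerivAt τ (σ x) x)
    (hτi : ∀ x ∈ Set.Icc xL xR, ∀ y ∈ Set.Icc xL xR, ∫ z in y..x, σT z = τ x - τ y)
    (m : Measure ℝ)
    (hm : m = (volume.restrict (Set.Icc xL xR)).withDensity fun x => ENNReal.ofReal (σ x))
    (A : ℝ → Lp ℝ 2 m →L[ℝ] Lp ℝ 2 m)
    (hA : ∀ μ : ℝ, μ ∈ Set.Icc (-1 : ℝ) 1 → μ ≠ 0 → ∀ φ : Lp ℝ 2 m,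
        ∀ᵐ x ∂m, (A μ φ) x = ∫ y in Set.Icc xL xR, transKernel σT σr μ x y * φ y * σT y)
    (ν μ : ℝ) (hν : 0 < ν) (hμ : ν ≤ μ) (hμ1 : μ ≤ 1) :
    ‖A μ - A ν‖ ≤ 2 * (μ - ν) / ν ∧ ‖A (-μ) - A (-ν)‖ ≤ 2 * (μ - ν) / ν := by
  have hμ0 : 0 < μ := hν.trans_le hμ
  have hc : 0 ≤ 2 * (μ - ν) / ν := by
    have := sub_nonneg.2 hμ
    positivity
  have hmono := tau_mono hpos hτ
  have hτc : Continuous τ := continuous_iff_continuousAt.2 fun x => (hτ x).continuousAt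
  have hr0 : ∀ y ∈ Set.Icc xL xR, 0 ≤ σr y / σT y := fun y hy =>
    div_nonneg (hσr_pos y hy).1.le ((hσr_pos y hy).1.le.trans (hσr_pos y hy).2)
  have hr1 : ∀ y ∈ Set.Icc xL xR, σr y / σT y ≤ 1 := fun y hy =>
    div_le_one_of_le₀ (hσr_pos y hy).2 ((hσr_pos y hy).1.le.trans (hσr_pos y hy).2)
  have hrm : AEStronglyMeasurable (fun y => σr y / σT y) (volume.restrict (Set.Icc xL xR)) := by
    apply ContinuousOn.aestronglyMeasurable _ measurableSet_Icc
    refine hσr.div (hσ.continuousOn.congr heq) fun y hy => ?_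
    rw [heq y hy]; exact (hpos y).ne'
  have kp : ∀ p, 0 < p → ∀ x ∈ Set.Icc xL xR, ∀ y ∈ Set.Icc xL xR,
      transKernel σT σr p x y
        = (if y ≤ x then (1/p) * Real.exp (-(1/p) * (τ x - τ y)) else 0) * (σr y / σT y) := by
    intro p hp x hx y hy
    rw [transKernel, if_pos hp, hτi x hx y hy]
    split_ifs <;> simp
  have kn : ∀ p, 0 < p → ∀ x ∈ Set.Icc xL xR, ∀ y ∈ Set.Icc xL xR,
      transKernel σT σr (-p) x y
        = (if x ≤ y then (1/p) * Real.exp (-(1/p) * (τ y - τ x)) else 0) * (σr y / σT y) := by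
    intro p hp x hx y hy
    rw [transKernel, if_neg (by linarith), hτi y hy x hx]
    have : 1 / -p = -(1/p) := by rw [div_neg]
    rw [this, neg_neg]
    split_ifs <;> simp
  have hgb : ∀ p, ν ≤ p → ∀ t, 0 ≤ t → |(1/p) * Real.exp (-(1/p) * t)| ≤ 1/ν := by
    intro p hp t ht
    have hp0 : 0 < p := hν.trans_le hp
    rw [abs_of_nonneg (by positivity)]
    have h1 : Real.exp (-(1/p) * t) ≤ 1 := by
      rw [Real.exp_le_one_iff]
      have : 0 ≤ (1/p) * t := by positivity
      linarith
    calc _ ≤ (1/p) * 1 := by gcongr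
      _ = 1/p := mul_one _
      _ ≤ 1/ν := one_div_le_one_div_of_le hν hp
  have h0ν : 0 ≤ 1/ν := by positivity
  have mulb : ∀ a b M : ℝ, |a| ≤ M → 0 ≤ b → b ≤ 1 → |a * b| ≤ M := by
    intro a b M ha hb hb1
    rw [abs_mul, abs_of_nonneg hb]
    nlinarith [abs_nonneg a]
  have bp : ∀ p, ν ≤ p → ∀ x ∈ Set.Icc xL xR, ∀ y ∈ Set.Icc xL xR,
      |transKernel σT σr p x y| ≤ 1/ν := by
    intro p hp x hx y hy
    rw [kp p (hν.trans_le hp) x hx y hy]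
    apply mulb _ _ _ _ (hr0 y hy) (hr1 y hy)
    split_ifs with h
    · exact hgb p hp _ (sub_nonneg.2 (hmono h))
    · simpa using hν.le
  have bn : ∀ p, ν ≤ p → ∀ x ∈ Set.Icc xL xR, ∀ y ∈ Set.Icc xL xR,
      |transKernel σT σr (-p) x y| ≤ 1/ν := by
    intro p hp x hx y hy
    rw [kn p (hν.trans_le hp) x hx y hy]
    apply mulb _ _ _ _ (hr0 y hy) (hr1 y hy)
    split_ifs with h
    · exact hgb p hp _ (sub_nonneg.2 (hmono h))
    · simpa using hν.le
  have mp : ∀ p, ν ≤ p → ∀ x ∈ Set.Icc xL xR,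
      AEStronglyMeasurable (transKernel σT σr p x) (volume.restrict (Set.Icc xL xR)) := by
    intro p hp x hx
    have : Measurable fun y =>
        (if y ≤ x then (1/p) * Real.exp (-(1/p) * (τ x - τ y)) else 0) := by
      apply Measurable.ite measurableSet_Iic _ measurable_const
      apply Continuous.measurable
      fun_prop
    refine (this.aestronglyMeasurable.mul hrm).congr ?_
    filter_upwards [ae_restrict_mem measurableSet_Icc] with y hy
    exact (kp p (hν.trans_le hp) x hx y hy).symm
  have mn : ∀ p, ν ≤ p → ∀ x ∈ Set.Icc xL xR,
      AEStronglyMeasurable (transKernel σT σr (-p) x) (volume.restrict (Set.Icc xL xR)) := by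
    intro p hp x hx
    have : Measurable fun y =>
        (if x ≤ y then (1/p) * Real.exp (-(1/p) * (τ y - τ x)) else 0) := by
      apply Measurable.ite measurableSet_Ici _ measurable_const
      apply Continuous.measurable
      fun_prop
    refine (this.aestronglyMeasurable.mul hrm).congr ?_
    filter_upwards [ae_restrict_mem measurableSet_Icc] with y hy
    exact (kn p (hν.trans_le hp) x hx y hy).symm
  constructor
  · refine diff_bound xL xR σ σT hσ hpos heq m hm (A μ) (A ν) _ _
      (hA μ ⟨by linarith, hμ1⟩ hμ0.ne') (hA ν ⟨by linarith, by linarith⟩ hν.ne')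
      (mp μ hμ) (mp ν le_rfl) (1/ν) (bp μ hμ) (bp ν le_rfl) (hk ν μ τ) (hk_meas ν μ hτc) ?_ _ hc
      ?_ ?_
    · intro x hx y hy
      rw [kp μ hμ0 x hx y hy, kp ν hν x hx y hy, ← sub_mul, ← ofReal_norm]
      by_cases h : y ≤ x
      · simp only [hk, if_pos h]
        apply ENNReal.ofReal_le_ofReal
        exact mulb _ _ _ (HH_bound hν hμ (sub_nonneg.2 (hmono h))) (hr0 y hy) (hr1 y hy)
      · simp [h]
    · intro x hx
      rw [hm]
      exact hk_row hν hμ hσ hpos hτ xL xR x hx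
    · intro x hx
      rw [hm]
      exact hk_col hν hμ hσ hpos hτ xL xR x hx
  · refine diff_bound xL xR σ σT hσ hpos heq m hm (A (-μ)) (A (-ν)) _ _
      (hA (-μ) ⟨by linarith, by linarith⟩ (neg_ne_zero.2 hμ0.ne'))
      (hA (-ν) ⟨by linarith, by linarith⟩ (neg_ne_zero.2 hν.ne'))
      (mn μ hμ) (mn ν le_rfl) (1/ν) (bn μ hμ) (bn ν le_rfl) (fun x y => hk ν μ τ y x)
      ((hk_meas ν μ hτc).comp measurable_swap) ?_ _ hc ?_ ?_
    · intro x hx y hy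
      rw [kn μ hμ0 x hx y hy, kn ν hν x hx y hy, ← sub_mul, ← ofReal_norm]
      by_cases h : x ≤ y
      · simp only [hk, if_pos h]
        apply ENNReal.ofReal_le_ofReal
        exact mulb _ _ _ (HH_bound hν hμ (sub_nonneg.2 (hmono h))) (hr0 y hy) (hr1 y hy)
      · simp [h]
    · intro x hx
      rw [hm]
      exact hk_col hν hμ hσ hpos hτ xL xR x hx
    · intro x hx
      rw [hm]
      exact hk_row hν hμ hσ hpos hτ xL xR x hx

lemma cell {E : Type*} [NormedAddCommGroup E] [NormedSpace ℝ E] [CompleteSpace E]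
    (f : ℝ → E) (u v p L : ℝ) (huv : u ≤ v) (hL : 0 ≤ L) (hp : p ∈ Set.Icc u v) (s : Set ℝ)
    (hs : MeasurableSet s) (hsu : s ⊆ Set.Icc u v) (hvol : volume s = ENNReal.ofReal (v - u))
    (hf : ∀ x ∈ Set.Icc u v, ∀ y ∈ Set.Icc u v, ‖f x - f y‖ ≤ L * |x - y|) :
    ‖(v - u) • f p - ∫ x in s, f x‖ ≤ L * (v - u) ^ 2 := by
  have hcont : ContinuousOn f (Set.Icc u v) := by
    have : LipschitzOnWith (Real.toNNReal L) f (Set.Icc u v) := by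
      apply LipschitzOnWith.of_dist_le_mul
      intro x hx y hy
      rw [dist_eq_norm, Real.dist_eq, Real.coe_toNNReal _ hL]
      exact hf x hx y hy
    exact this.continuousOn
  have hi : IntegrableOn f s := hcont.integrableOn_Icc.mono_set hsu
  have hr : volume.real s = v - u := by
    rw [Measure.real, hvol, ENNReal.toReal_ofReal (sub_nonneg.2 huv)]
  have hlt : volume s < ∞ := by rw [hvol]; exact ENNReal.ofReal_lt_top
  have e : (v - u) • f p - ∫ x in s, f x = ∫ x in s, (f p - f x) := by
    rw [integral_sub _ hi, setIntegral_const, hr]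
    exact integrableOn_const hlt.ne
  rw [e]
  have := norm_setIntegral_le_of_norm_le_const (μ := volume) (s := s) (f := fun x => f p - f x)
    (C := L * (v - u)) hlt ?_
  · rw [hr] at this
    calc _ ≤ _ := this
      _ = _ := by ring
  · intro x hx
    refine (hf p hp x (hsu hx)).trans ?_
    gcongr
    have := hsu hx
    rw [abs_le]
    constructor <;> linarith [hp.1, hp.2, this.1, this.2]

end ROM

/-- **Uniform smallness of the cellwise ROM fluctuation operators** (Lemma 4.1, third
part): there is a constant `C > 0` depending only on `σ_T`, `σ_r` and the uniform bound
`K` on the rescaled weights `α_ℓ = n|S_ℓ|/|S|` (not on `n`, `ℓ`, `δ` or the sample)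
such that for every even `n = 2m`, every symmetric partition of `S^δ` into cells
`S_ℓ = (a_ℓ, a_{ℓ+1}]` (and reflections), and every realization `μ_ℓ ∈ S_ℓ` of the
random ordinates, `‖δT_ℓ^ξ‖ ≤ (C/δ) n⁻¹` for all `ℓ`, and hence
`‖δT^ξ‖ = ‖(1/m) Σ_ℓ δT_ℓ^ξ‖ ≤ (C/δ) n⁻¹`. -/
theorem cellwise_fluctuation_uniform_bound
    (xL xR : ℝ) (hx : xL < xR)
    (σT σr : ℝ → ℝ)
    (hσT : ContinuousOn σT (Set.Icc xL xR)) (hσT_pos : ∀ x ∈ Set.Icc xL xR, 0 < σT x)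
    (hσr : ContinuousOn σr (Set.Icc xL xR))
    (hσr_pos : ∀ x ∈ Set.Icc xL xR, 0 < σr x ∧ σr x ≤ σT x)
    (A : ℝ → Lp ℝ 2 (transMeasure xL xR σT) →L[ℝ] Lp ℝ 2 (transMeasure xL xR σT))
    (hA : ∀ μ : ℝ, μ ∈ Set.Icc (-1 : ℝ) 1 → μ ≠ 0 →
      ∀ φ : Lp ℝ 2 (transMeasure xL xR σT),
        ∀ᵐ x ∂(transMeasure xL xR σT),
          (A μ φ) x = ∫ y in Set.Icc xL xR, transKernel σT σr μ x y * φ y * σT y)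
    (K : ℝ) (hK : 0 < K) :
    ∃ C : ℝ, 0 < C ∧
      ∀ (δ : ℝ), δ ∈ Set.Ioo (0 : ℝ) 1 →
      ∀ (m : ℕ), 0 < m →
      ∀ a : ℕ → ℝ, a 0 = δ → a m = 1 → (∀ ℓ < m, a ℓ < a (ℓ + 1)) →
      -- the rescaled weights `α_ℓ = m(a_{ℓ+1} − a_ℓ)` are bounded by `K`
      (∀ ℓ < m, (m : ℝ) * (a (ℓ + 1) - a ℓ) ≤ K) →
      ∀ μval : ℕ → ℝ, (∀ ℓ < m, μval ℓ ∈ Set.Ioc (a ℓ) (a (ℓ + 1))) →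
      -- `δT_ℓ^ξ`, combining the cell `S_ℓ` and its reflection `S_{n+1−ℓ}`
      (let δTl : ℕ → Lp ℝ 2 (transMeasure xL xR σT) →L[ℝ] Lp ℝ 2 (transMeasure xL xR σT) :=
        fun ℓ => (2 : ℝ)⁻¹ •
          (((m : ℝ) * (a (ℓ + 1) - a ℓ)) • A (μval ℓ)
            - (m : ℝ) • (∫ μ in Set.Ioc (a ℓ) (a (ℓ + 1)), A μ)
            + ((m : ℝ) * (a (ℓ + 1) - a ℓ)) • A (-(μval ℓ))
            - (m : ℝ) • (∫ μ in Set.Ico (-(a (ℓ + 1))) (-(a ℓ)), A μ));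
      (∀ ℓ < m, ‖δTl ℓ‖ ≤ C / δ * ((2 * m : ℕ) : ℝ)⁻¹) ∧
        ‖(m : ℝ)⁻¹ • ∑ ℓ ∈ Finset.range m, δTl ℓ‖ ≤ C / δ * ((2 * m : ℕ) : ℝ)⁻¹) := by
  classical
  let σ : ℝ → ℝ := Set.IccExtend hx.le ((Set.Icc xL xR).domRestrict σT)
  have hσ : Continuous σ := (continuousOn_iff_continuous_domRestrict.1 hσT).Icc_extend'
  have heq : ∀ x ∈ Set.Icc xL xR, σT x = σ x := fun x h => by
    simp only [σ, Set.IccExtend_of_mem hx.le _ h, Set.domRestrict_apply]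
  have hpos : ∀ x, 0 < σ x := fun x => hσT_pos _ (Set.projIcc xL xR hx.le x).2
  let τ : ℝ → ℝ := fun x => ∫ z in xL..x, σ z
  have hτ : ∀ x, HasDerivAt τ (σ x) x := fun x => hσ.integral_hasStrictDerivAt xL x |>.hasDerivAt
  have hτi : ∀ x ∈ Set.Icc xL xR, ∀ y ∈ Set.Icc xL xR, ∫ z in y..x, σT z = τ x - τ y := by
    intro x h y h'
    have e : ∫ z in y..x, σT z = ∫ z in y..x, σ z := by
      apply intervalIntegral.integral_congr
      intro z hz
      exact heq z (Set.uIcc_subset_Icc h' h hz)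
    rw [e]
    exact (intervalIntegral.integral_interval_sub_left (hσ.intervalIntegrable _ _)
      (hσ.intervalIntegrable _ _)).symm
  have hm : transMeasure xL xR σT = (volume.restrict (Set.Icc xL xR)).withDensity
      fun x => ENNReal.ofReal (σ x) := by
    rw [transMeasure]
    apply withDensity_congr_ae
    filter_upwards [ae_restrict_mem measurableSet_Icc] with x h
    rw [heq x h]
  have lip := ROM.lip_pos xL xR σ σT σr τ hσ hpos heq hσr hσr_pos hτ hτi (transMeasure xL xR σT) hm A hA
  refine ⟨4 * K ^ 2, by positivity, ?_⟩
  intro δ hδ m hmpos a ha0 ham hastep hαK μval hμval δTl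
  have hδ0 : 0 < δ := hδ.1
  have lipP : ∀ x ∈ Set.Icc δ 1, ∀ y ∈ Set.Icc δ 1,
      ‖A x - A y‖ ≤ 2 / δ * |x - y| ∧ ‖A (-x) - A (-y)‖ ≤ 2 / δ * |x - y| := by
    have aux : ∀ x ∈ Set.Icc δ 1, ∀ y ∈ Set.Icc δ 1, y ≤ x →
      ‖A x - A y‖ ≤ 2 / δ * |x - y| ∧ ‖A (-x) - A (-y)‖ ≤ 2 / δ * |x - y| := by
      intro x h y h' hyx
      have hy0 : 0 < y := hδ0.trans_le h'.1
      have hb : 2 * (x - y) / y ≤ 2 / δ * |x - y| := by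
        rw [abs_of_nonneg (sub_nonneg.2 hyx), div_mul_eq_mul_div]
        apply div_le_div_of_nonneg_left _ hδ0 h'.1
        linarith
      have := lip y x hy0 hyx h.2
      exact ⟨this.1.trans hb, this.2.trans hb⟩
    intro x h y h'
    rcases le_total y x with hyx | hyx
    · exact aux x h y h' hyx
    · have := aux y h' x h hyx
      rw [norm_sub_rev, abs_sub_comm, norm_sub_rev (A (-x))]
      exact this
  have hage : ∀ ℓ ≤ m, δ ≤ a ℓ := by
    intro ℓ
    induction ℓ with
    | zero => intro _; rw [ha0]
    | succ k ih => intro hk; exact (ih (by omega)).trans (hastep k (by omega)).le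
  have hale : ∀ j ≤ m, a (m - j) ≤ 1 := by
    intro j
    induction j with
    | zero => intro _; simp [ham]
    | succ k ih =>
      intro hk
      have h1 := hastep (m - (k + 1)) (by omega)
      have h2 : m - (k + 1) + 1 = m - k := by omega
      rw [h2] at h1
      exact h1.le.trans (ih (by omega))
  have hale' : ∀ ℓ ≤ m, a ℓ ≤ 1 := by
    intro ℓ hℓ
    have := hale (m - ℓ) (by omega)
    rwa [Nat.sub_sub_self hℓ] at this
  have hmR : (0 : ℝ) < m := by exact_mod_cast hmpos
  have main : ∀ ℓ < m, ‖δTl ℓ‖ ≤ 4 * K ^ 2 / δ * ((2 * m : ℕ) : ℝ)⁻¹ := by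
    intro ℓ hℓ
    have h1 := hage ℓ hℓ.le
    have h2 := hale' (ℓ + 1) hℓ
    have h3 := hastep ℓ hℓ
    have hμ := hμval ℓ hℓ
    have hK' := hαK ℓ hℓ
    have hL : 0 ≤ 2 / δ := by positivity
    have c1 := ROM.cell A (a ℓ) (a (ℓ + 1)) (μval ℓ) (2 / δ) h3.le hL ⟨hμ.1.le, hμ.2⟩
      (Set.Ioc (a ℓ) (a (ℓ + 1))) measurableSet_Ioc Set.Ioc_subset_Icc_self Real.volume_Ioc
      (fun x hx y hy => (lipP x ⟨h1.trans hx.1, hx.2.trans h2⟩ y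
        ⟨h1.trans hy.1, hy.2.trans h2⟩).1)
    have c2 := ROM.cell A (-a (ℓ + 1)) (-a ℓ) (-μval ℓ) (2 / δ) (by linarith) hL
      ⟨by linarith [hμ.2], by linarith [hμ.1]⟩
      (Set.Ico (-a (ℓ + 1)) (-a ℓ)) measurableSet_Ico Set.Ico_subset_Icc_self Real.volume_Ico
      (fun x hx y hy => by
        have := (lipP (-x) ⟨by linarith [hx.2], by linarith [hx.1]⟩ (-y)
          ⟨by linarith [hy.2], by linarith [hy.1]⟩).2
        rw [neg_neg, neg_neg] at this
        refine this.trans (le_of_eq ?_)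
        rw [← abs_neg]
        congr 2
        ring)
    have ew : -a ℓ - -a (ℓ + 1) = a (ℓ + 1) - a ℓ := by ring
    rw [ew] at c2
    set w := a (ℓ + 1) - a ℓ with hw
    have hw0 : 0 < w := by rw [hw]; linarith
    have ed : δTl ℓ = ((2 : ℝ)⁻¹ * m) • ((w • A (μval ℓ) - ∫ μ in Set.Ioc (a ℓ) (a (ℓ + 1)), A μ)
        + (w • A (-μval ℓ) - ∫ μ in Set.Ico (-a (ℓ + 1)) (-a ℓ), A μ)) := by
      simp only [δTl]
      rw [← hw]
      module
    rw [ed, norm_smul, Real.norm_of_nonneg (by positivity)]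
    calc (2 : ℝ)⁻¹ * m * _ ≤ (2 : ℝ)⁻¹ * m * (2 / δ * w ^ 2 + 2 / δ * w ^ 2) := by
          gcongr
          exact (norm_add_le _ _).trans (add_le_add c1 c2)
      _ = 2 / δ * (m * w) ^ 2 * (m : ℝ)⁻¹ := by
          field_simp
          ring
      _ ≤ 2 / δ * K ^ 2 * (m : ℝ)⁻¹ := by gcongr
      _ = _ := by
          push_cast
          field_simp
          ring
  refine ⟨main, ?_⟩
  rw [norm_smul, Real.norm_of_nonneg (by positivity)]
  calc (m : ℝ)⁻¹ * _ ≤ (m : ℝ)⁻¹ * ∑ ℓ ∈ Finset.range m, 4 * K ^ 2 / δ * ((2 * m : ℕ) : ℝ)⁻¹ := by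
        gcongr
        exact norm_sum_le_of_le _ fun ℓ hℓ => main ℓ (Finset.mem_range.1 hℓ)
    _ = _ := by
        rw [Finset.sum_const, Finset.card_range, nsmul_eq_mul, ← mul_assoc,
          inv_mul_cancel₀ hmR.ne', one_mul]
end

section
/- Compactness and trace bound for the transport operator (Proposition 4.4): for every μ∈[−1,1]∖{0}, the operator A_μ on L²(Ω;σ_T) is compact, and for every orthonormal basis (e_i) of L²(Ω;σ_T) one has Σ_i‖A_μe_i‖² = ∫_{x_L}^{x_R}∫_{x_L}^{x_R} k_μ(x,y)² σ_T(x)σ_T(y) dx dy ≤ (1/|μ|)·(x_R−x_L)·(sup_Ω σ_T)²·(sup_Ω 1/σ_T). In particular A_μ*A_μ and A_μA_μ* are trace class with tr(A_μ*A_μ)=tr(A_μA_μ*) bounded by the same quantity. -/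
open MeasureTheory

lemma tr_parseval {E ι : Type*} [NormedAddCommGroup E] [InnerProductSpace ℝ E]
    (e : HilbertBasis ι ℝ E) (v : E) :
    HasSum (fun i => (inner ℝ (e i) v) ^ 2) (‖v‖ ^ 2) := by
  have h := e.hasSum_inner_mul_inner v v
  rw [real_inner_self_eq_norm_sq] at h
  simpa only [real_inner_comm v, ← sq] using h

lemma tr_parseval_ennreal {E ι : Type*} [NormedAddCommGroup E] [InnerProductSpace ℝ E]
    (e : HilbertBasis ι ℝ E) (v : E) :
    ∑' i, ENNReal.ofReal ((inner ℝ (e i) v) ^ 2) = ENNReal.ofReal (‖v‖ ^ 2) := by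
  rw [← (tr_parseval e v).tsum_eq, ENNReal.ofReal_tsum_of_nonneg (fun i => sq_nonneg _)
    (tr_parseval e v).summable]

lemma tr_hasSum_of_ennreal {ι : Type*} (f : ι → ℝ) (hf : ∀ i, 0 ≤ f i) (a : ℝ) (ha : 0 ≤ a)
    (h : ∑' i, ENNReal.ofReal (f i) = ENNReal.ofReal a) : HasSum f a := by
  have hs : Summable f := by
    have := ENNReal.summable_toReal (f := fun i => ENNReal.ofReal (f i)) (by rw [h]; simp)
    simpa [ENNReal.toReal_ofReal, hf] using this
  have h2 := hs.hasSum
  rw [← ENNReal.ofReal_tsum_of_nonneg hf hs, ENNReal.ofReal_eq_ofReal_iff (tsum_nonneg hf) ha] at h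
  rwa [h] at h2

lemma tr_adjoint {E ι : Type*} [NormedAddCommGroup E] [InnerProductSpace ℝ E] [CompleteSpace E]
    (e : HilbertBasis ι ℝ E) (A : E →L[ℝ] E) (a : ℝ) (h : HasSum (fun i => ‖A (e i)‖ ^ 2) a) :
    HasSum (fun i => ‖ContinuousLinearMap.adjoint A (e i)‖ ^ 2) a := by
  have ha : 0 ≤ a := h.nonneg (fun i => sq_nonneg _)
  refine tr_hasSum_of_ennreal _ (fun i => sq_nonneg _) a ha ?_
  calc _ = ∑' i, ∑' j, ENNReal.ofReal ((inner ℝ (e j) (ContinuousLinearMap.adjoint A (e i))) ^ 2) := by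
        simp_rw [tr_parseval_ennreal e]
    _ = ∑' j, ∑' i, ENNReal.ofReal ((inner ℝ (e i) (A (e j))) ^ 2) := by
        rw [ENNReal.tsum_comm]
        simp_rw [ContinuousLinearMap.adjoint_inner_right, real_inner_comm]
    _ = _ := by
        simp_rw [tr_parseval_ennreal e]
        rw [← h.tsum_eq, ENNReal.ofReal_tsum_of_nonneg (fun i => sq_nonneg _) h.summable]

lemma tr_countable {E ι : Type*} [NormedAddCommGroup E] [InnerProductSpace ℝ E]
    [SecondCountableTopology E] (e : HilbertBasis ι ℝ E) : Countable ι := by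
  have hd : Pairwise (Function.onFun Disjoint (fun i => Metric.ball (e i) (1/2))) := by
    intro i j hij
    apply Metric.ball_disjoint_ball
    have h1 : ‖e i - e j‖ ^ 2 = 2 := by
      rw [@norm_sub_sq_real, e.orthonormal.1, e.orthonormal.1, e.orthonormal.2 hij]; norm_num
    rw [dist_eq_norm]
    nlinarith [norm_nonneg (e i - e j)]
  have := Set.PairwiseDisjoint.countable_of_isOpen (a := Set.univ)
    (s := fun i => Metric.ball (e i) (1/2)) (fun i _ j _ h => hd h)
    (fun _ _ => Metric.isOpen_ball) (fun i _ => ⟨e i, by simp⟩)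
  exact Set.countable_univ_iff.mp this

lemma tr_compact {E ι : Type*} [NormedAddCommGroup E] [InnerProductSpace ℝ E] [CompleteSpace E]
    (e : HilbertBasis ι ℝ E) (A : E →L[ℝ] E) (h : Summable (fun i => ‖A (e i)‖ ^ 2)) :
    IsCompactOperator A := by
  classical
  let T : Finset ι → (E →L[ℝ] E) := fun s =>
    ∑ i ∈ s, (innerSL ℝ (e i)).smulRight (A (e i))
  have hT : ∀ s v, T s v = ∑ i ∈ s, inner ℝ (e i) v • A (e i) := by
    intro s v; simp [T]
  have hlim : ∀ v, Filter.Tendsto (fun s => T s v) Filter.atTop (nhds (A v)) := by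
    intro v
    have := (e.hasSum_repr v).mapL A
    simp only [e.repr_apply_apply, map_smul] at this
    simpa [HasSum, hT] using this
  refine isCompactOperator_of_tendsto (l := Filter.atTop) (F := T) ?_ (Filter.Eventually.of_forall ?_)
  · rw [Metric.tendsto_atTop]
    intro ε hε
    obtain ⟨s, hs⟩ := summable_iff_vanishing_norm.1 h ((ε/2)^2) (by positivity)
    refine ⟨s, fun s' hss => ?_⟩
    rw [dist_comm, dist_eq_norm]
    refine lt_of_le_of_lt (ContinuousLinearMap.opNorm_le_bound _ (by positivity : (0:ℝ) ≤ ε/2) ?_) (by linarith)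
    intro v
    have h1 : Filter.Tendsto (fun t => ‖T t v - T s' v‖) Filter.atTop (nhds (‖(A - T s') v‖)) := by
      simpa using ((hlim v).sub_const (T s' v)).norm
    refine le_of_tendsto h1 ?_
    filter_upwards [Filter.eventually_ge_atTop s'] with t ht
    rw [hT, hT, ← Finset.sum_sdiff (show s' ⊆ t from ht), add_sub_cancel_right]
    refine (norm_sum_le _ _).trans ?_
    have h2 := Finset.sum_mul_sq_le_sq_mul_sq (t \ s') (fun i => ‖inner ℝ (e i) v‖) (fun i => ‖A (e i)‖)
    have h3 := e.orthonormal.sum_inner_products_le v (s := t \ s')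
    have h4 := hs (t \ s') (Finset.disjoint_left.2 fun i hi hi' => (Finset.mem_sdiff.1 hi).2 (hss hi'))
    rw [Real.norm_of_nonneg (Finset.sum_nonneg fun i _ => sq_nonneg _)] at h4
    simp_rw [norm_smul]
    refine abs_le_of_sq_le_sq' (h2.trans ?_) (by positivity) |>.2
    rw [mul_pow, mul_comm]
    gcongr
  · intro s
    have : IsCompactOperator (T s) := by
      have hmem : T s ∈ compactOperator (RingHom.id ℝ) E E := by
        refine Submodule.sum_mem _ fun i _ => ?_
        have h1 : IsCompactOperator (innerSL ℝ (e i)) :=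
          isCompactOperator_of_locallyCompactSpace_dom _
        exact h1.continuous_comp (g := fun c : ℝ => c • A (e i)) (by fun_prop)
      exact hmem
    exact this

lemma tr_norm_sq (ν : Measure ℝ) (f : Lp ℝ 2 ν) : ‖f‖ ^ 2 = ∫ x, (f x) ^ 2 ∂ν := by
  rw [← real_inner_self_eq_norm_sq, L2.inner_def]
  simp [sq]

lemma tr_HS {ι : Type*} (ν : Measure ℝ) [IsFiniteMeasure ν] (K : ℝ → ℝ → ℝ)
    (hK : Measurable (Function.uncurry K)) (C : ℝ) (hC : ∀ x y, |K x y| ≤ C)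
    (A : Lp ℝ 2 ν →L[ℝ] Lp ℝ 2 ν)
    (hA : ∀ φ : Lp ℝ 2 ν, ∀ᵐ x ∂ν, A φ x = ∫ y, K x y * φ y ∂ν)
    (e : HilbertBasis ι ℝ (Lp ℝ 2 ν)) :
    HasSum (fun i => ‖A (e i)‖ ^ 2) (∫ x, ∫ y, K x y ^ 2 ∂ν ∂ν) := by
  have : Fact ((2 : ENNReal) ≠ ⊤) := ⟨by simp⟩
  have : Countable ι := tr_countable e
  have hKx : ∀ x, MemLp (K x) 2 ν := fun x =>
    MemLp.of_bound (hK.comp measurable_prodMk_left).aestronglyMeasurable C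
      (Filter.Eventually.of_forall fun y => hC x y)
  let k : ℝ → Lp ℝ 2 ν := fun x => (hKx x).toLp
  have hk : ∀ x (φ : Lp ℝ 2 ν), inner ℝ φ (k x) = ∫ y, K x y * φ y ∂ν := by
    intro x φ
    rw [L2.inner_def]
    refine integral_congr_ae ?_
    filter_upwards [(hKx x).coeFn_toLp] with y hy
    simp [k, hy]
  have hkn : ∀ x, ‖k x‖ ^ 2 = ∫ y, K x y ^ 2 ∂ν := by
    intro x
    rw [tr_norm_sq]
    refine integral_congr_ae ?_
    filter_upwards [(hKx x).coeFn_toLp] with y hy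
    simp [k, hy]
  have hm : StronglyMeasurable (fun x => ∫ y, K x y ^ 2 ∂ν) :=
    StronglyMeasurable.integral_prod_right (f := fun x y => K x y ^ 2)
      (hK.pow_const 2).stronglyMeasurable
  have h0 : ∀ x, 0 ≤ ∫ y, K x y ^ 2 ∂ν := fun x => integral_nonneg fun y => sq_nonneg _
  have hi : Integrable (fun x => ∫ y, K x y ^ 2 ∂ν) ν := by
    refine Integrable.of_bound hm.aestronglyMeasurable (C ^ 2 * ν.real Set.univ)
      (Filter.Eventually.of_forall fun x => ?_)
    refine norm_integral_le_of_norm_le_const (Filter.Eventually.of_forall fun y => ?_)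
    rw [norm_pow]
    exact pow_le_pow_left₀ (norm_nonneg _) (hC x y) 2
  refine tr_hasSum_of_ennreal _ (fun i => sq_nonneg _) _ (integral_nonneg h0) ?_
  calc ∑' i, ENNReal.ofReal (‖A (e i)‖ ^ 2)
      = ∑' i, ∫⁻ x, ENNReal.ofReal ((inner ℝ (e i) (k x)) ^ 2) ∂ν := by
        congr 1; ext i
        rw [tr_norm_sq, ofReal_integral_eq_lintegral_ofReal]
        · refine lintegral_congr_ae ?_
          filter_upwards [hA (e i)] with x hx
          rw [hx, hk]
        · exact (Lp.memLp (A (e i))).integrable_sq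
        · exact Filter.Eventually.of_forall fun x => sq_nonneg _
    _ = ∫⁻ x, ∑' i, ENNReal.ofReal ((inner ℝ (e i) (k x)) ^ 2) ∂ν := by
        rw [lintegral_tsum]
        intro i
        refine AEMeasurable.ennreal_ofReal (AEMeasurable.pow_const ?_ 2)
        refine (Lp.aestronglyMeasurable (A (e i))).aemeasurable.congr ?_
        filter_upwards [hA (e i)] with x hx
        rw [hx, hk]
    _ = _ := by
        simp_rw [tr_parseval_ennreal e, hkn]
        rw [ofReal_integral_eq_lintegral_ofReal hi (Filter.Eventually.of_forall h0)]

lemma tr_kernel_bound (s r : ℝ → ℝ) (hs : Continuous s)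
    (hs0 : ∀ x, 0 < s x) (hr0 : ∀ x, 0 < r x ∧ r x ≤ s x) (μ : ℝ) (hμ : μ ≠ 0) (x y : ℝ) :
    |transKernel s r μ x y| ≤ 1 / |μ| := by
  have hq0 : 0 ≤ r y / s y := div_nonneg (hr0 y).1.le (hs0 y).le
  have hq1 : r y / s y ≤ 1 := (div_le_one (hs0 y)).2 (hr0 y).2
  unfold transKernel
  split_ifs with h1 h2 h2
  · have hI : 0 ≤ ∫ z in y..x, s z := intervalIntegral.integral_nonneg h2 fun z _ => (hs0 z).le
    have hE : Real.exp (-(1 / μ) * ∫ z in y..x, s z) ≤ 1 := by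
      rw [Real.exp_le_one_iff, neg_mul]
      have : 0 ≤ 1 / μ * ∫ z in y..x, s z := by positivity
      linarith
    rw [abs_of_pos h1, abs_of_nonneg (by positivity), mul_assoc]
    refine mul_le_of_le_one_right (by positivity) ?_
    exact mul_le_one₀ hE hq0 hq1
  · simp
  · have h3 : μ < 0 := lt_of_le_of_ne (not_lt.1 h1) hμ
    have h4 : 0 < -(1 / μ) := by rw [← one_div_neg_eq_neg_one_div]; exact one_div_pos.2 (by linarith)
    have hI : 0 ≤ ∫ z in x..y, s z := intervalIntegral.integral_nonneg h2 fun z _ => (hs0 z).le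
    have hE : Real.exp ((1 / μ) * ∫ z in x..y, s z) ≤ 1 := by
      rw [Real.exp_le_one_iff]
      nlinarith
    rw [abs_of_neg h3, abs_of_nonneg (by positivity), mul_assoc, one_div_neg_eq_neg_one_div]
    refine mul_le_of_le_one_right h4.le ?_
    exact mul_le_one₀ hE hq0 hq1
  · simp

lemma tr_integral_sub (s : ℝ → ℝ) (hs : Continuous s) (a x y : ℝ) :
    ∫ z in y..x, s z = (∫ z in a..x, s z) - ∫ z in a..y, s z := by
  rw [intervalIntegral.integral_interval_sub_left] <;> exact hs.intervalIntegrable _ _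

lemma tr_kernel_meas (s r : ℝ → ℝ) (hs : Continuous s) (hr : Continuous r) (μ : ℝ) :
    Measurable (Function.uncurry (transKernel s r μ)) := by
  have hG : Continuous fun x => ∫ z in (0:ℝ)..x, s z :=
    intervalIntegral.continuous_primitive (fun a b => hs.intervalIntegrable a b) 0
  have hGm := hG.measurable
  have hsm := hs.measurable
  have hrm := hr.measurable
  unfold transKernel Function.uncurry
  split_ifs with h1
  · refine Measurable.ite (measurableSet_le measurable_snd measurable_fst) ?_ measurable_const
    have hI : ∀ p : ℝ × ℝ, ∫ z in p.2..p.1, s z = (∫ z in (0:ℝ)..p.1, s z) - ∫ z in (0:ℝ)..p.2, s z :=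
      fun p => tr_integral_sub s hs 0 _ _
    simp only [hI]
    fun_prop
  · refine Measurable.ite (measurableSet_le measurable_fst measurable_snd) ?_ measurable_const
    have hI : ∀ p : ℝ × ℝ, ∫ z in p.1..p.2, s z = (∫ z in (0:ℝ)..p.2, s z) - ∫ z in (0:ℝ)..p.1, s z :=
      fun p => tr_integral_sub s hs 0 _ _
    simp only [hI]
    fun_prop

lemma tr_inner_bound (s r : ℝ → ℝ) (hs : Continuous s) (hr : Continuous r)
    (hs0 : ∀ x, 0 < s x) (hr0 : ∀ x, 0 < r x ∧ r x ≤ s x) (μ : ℝ) (hμ : μ ≠ 0)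
    (a b x : ℝ) (hx : x ∈ Set.Icc a b) :
    ∫ y in Set.Icc a b, transKernel s r μ x y ^ 2 * s y ≤ 1 / |μ| := by
  set G : ℝ → ℝ := fun x => ∫ z in a..x, s z with hGdef
  have hGd : ∀ y, HasDerivAt G (s y) y := fun y => hs.integral_hasStrictDerivAt a y |>.hasDerivAt
  have hG : Continuous G := continuous_iff_continuousAt.2 fun y => (hGd y).continuousAt
  have hmeas : Measurable fun y => transKernel s r μ x y ^ 2 * s y :=
    (((tr_kernel_meas s r hs hr μ).comp measurable_prodMk_left).pow_const 2).mul hs.measurable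
  -- pointwise control with `c = 1 / μ`
  set c : ℝ := 1 / μ with hc
  have hc0 : c ≠ 0 := one_div_ne_zero hμ
  let F : ℝ → ℝ := fun y => c ^ 2 * Real.exp (-(2 * c) * (G x - G y)) * s y
  let P : ℝ → ℝ := fun y => c / 2 * Real.exp (-(2 * c) * (G x - G y))
  have hF : Continuous F := by fun_prop
  have hP : ∀ y, HasDerivAt P (F y) y := by
    intro y
    have h1 := ((((hGd y).const_sub (G x)).const_mul (-(2 * c))).exp).const_mul (c / 2)
    convert! h1 using 1
    simp only [F]; ring
  have hFTC : ∀ u v, ∫ y in u..v, F y = P v - P u := fun u v =>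
    intervalIntegral.integral_eq_sub_of_hasDerivAt (fun y _ => hP y) (hF.intervalIntegrable _ _)
  have hF0 : ∀ y, 0 ≤ F y := fun y => by have := hs0 y; positivity
  have hPx : P x = c / 2 := by simp [P]
  have hq : ∀ y, (r y / s y) ^ 2 ≤ 1 := fun y =>
    pow_le_one₀ (div_nonneg (hr0 y).1.le (hs0 y).le) ((div_le_one (hs0 y)).2 (hr0 y).2)
  have hint : ∀ S : Set ℝ, MeasurableSet S →
      IntegrableOn (S.indicator F) (Set.Icc a b) := fun S hS =>
    (hF.continuousOn.integrableOn_Icc).indicator hS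
  have key : ∀ S : Set ℝ, MeasurableSet S →
      (∀ y, transKernel s r μ x y ^ 2 * s y ≤ S.indicator F y) →
      ∫ y in Set.Icc a b, transKernel s r μ x y ^ 2 * s y ≤ ∫ y in Set.Icc a b ∩ S, F y := by
    intro S hS h
    rw [← setIntegral_indicator hS]
    refine integral_mono_of_nonneg (Filter.Eventually.of_forall fun y => ?_) (hint S hS)
      (Filter.Eventually.of_forall h)
    have := hs0 y
    positivity
  rcases lt_or_gt_of_ne hμ with hneg | hpos
  · have hcn : c < 0 := by rw [hc]; exact one_div_neg.2 hneg
    refine (key (Set.Ici x) measurableSet_Ici fun y => ?_).trans ?_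
    · by_cases hy : x ≤ y
      · rw [Set.indicator_of_mem (by simpa using hy)]
        have hI : ∫ z in x..y, s z = G y - G x := tr_integral_sub s hs a y x
        simp only [transKernel, not_lt.2 hneg.le, if_false, hy, if_true, F, ← hc, hI]
        have : Real.exp (-(2 * c) * (G x - G y)) = Real.exp (c * (G y - G x)) ^ 2 := by
          rw [← Real.exp_nat_mul]; congr 1; push_cast; ring
        rw [this]
        refine mul_le_mul_of_nonneg_right ?_ (hs0 y).le
        rw [mul_pow, mul_pow, neg_sq]
        exact mul_le_of_le_one_right (by positivity) (hq y)
      · rw [Set.indicator_of_notMem (by simpa using hy)]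
        simp [transKernel, not_lt.2 hneg.le, hy]
    · have hset : Set.Icc a b ∩ Set.Ici x = Set.Icc x b := by
        ext y; simp only [Set.mem_inter_iff, Set.mem_Icc, Set.mem_Ici]
        exact ⟨fun h => ⟨h.2, h.1.2⟩, fun h => ⟨⟨hx.1.trans h.1, h.2⟩, h.1⟩⟩
      rw [hset, integral_Icc_eq_integral_Ioc, ← intervalIntegral.integral_of_le hx.2, hFTC, hPx,
        abs_of_neg hneg, one_div_neg_eq_neg_one_div, ← hc]
      have : P b ≤ 0 := mul_nonpos_of_nonpos_of_nonneg (by linarith) (Real.exp_pos _).le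
      linarith
  · have hcp : 0 < c := by rw [hc]; exact one_div_pos.2 hpos
    refine (key (Set.Iic x) measurableSet_Iic fun y => ?_).trans ?_
    · by_cases hy : y ≤ x
      · rw [Set.indicator_of_mem (by simpa using hy)]
        have hI : ∫ z in y..x, s z = G x - G y := tr_integral_sub s hs a x y
        simp only [transKernel, hpos, if_true, hy, F, ← hc, hI]
        have : Real.exp (-(2 * c) * (G x - G y)) = Real.exp (-c * (G x - G y)) ^ 2 := by
          rw [← Real.exp_nat_mul]; congr 1; push_cast; ring
        rw [this]
        refine mul_le_mul_of_nonneg_right ?_ (hs0 y).le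
        rw [mul_pow, mul_pow]
        exact mul_le_of_le_one_right (by positivity) (hq y)
      · rw [Set.indicator_of_notMem (by simpa using hy)]
        simp [transKernel, hpos, hy]
    · have hset : Set.Icc a b ∩ Set.Iic x = Set.Icc a x := by
        ext y; simp only [Set.mem_inter_iff, Set.mem_Icc, Set.mem_Iic]
        exact ⟨fun h => ⟨h.1.1, h.2⟩, fun h => ⟨⟨h.1, h.2.trans hx.2⟩, h.2⟩⟩
      rw [hset, integral_Icc_eq_integral_Ioc, ← intervalIntegral.integral_of_le hx.1, hFTC, hPx,
        abs_of_pos hpos, ← hc]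
      have : 0 ≤ P a := mul_nonneg (by linarith) (Real.exp_pos _).le
      linarith

lemma tr_integral_measure (xL xR : ℝ) (σT : ℝ → ℝ) (hσT : ContinuousOn σT (Set.Icc xL xR))
    (hpos : ∀ x ∈ Set.Icc xL xR, 0 < σT x) (f : ℝ → ℝ) :
    ∫ x, f x ∂(transMeasure xL xR σT) = ∫ x in Set.Icc xL xR, f x * σT x := by
  unfold transMeasure
  rw [integral_withDensity_eq_integral_toReal_smul₀
    (hσT.aemeasurable measurableSet_Icc).ennreal_ofReal
    (Filter.Eventually.of_forall fun _ => ENNReal.ofReal_lt_top)]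
  refine setIntegral_congr_fun measurableSet_Icc fun x hx => ?_
  simp [ENNReal.toReal_ofReal (hpos x hx).le, mul_comm]

/-- **Compactness and trace bound for the transport operator** (Proposition 4.4):
for `μ ∈ [−1,1] \ {0}`, `A_μ` is compact, and for every orthonormal (Hilbert) basis
`(e_i)` of `L²(Ω;σ_T)`, `Σ_i ‖A_μ e_i‖² = ∬ k_μ(x,y)² σ_T(x) σ_T(y) dx dy
≤ |μ|⁻¹ (x_R−x_L) (sup σ_T)² (sup 1/σ_T)`; the same holds for the adjoint, so that
`A_μ* A_μ` and `A_μ A_μ*` are trace class with equal traces bounded by that quantity. -/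
theorem transport_operator_compact_trace_bound
    (xL xR : ℝ) (hx : xL < xR)
    (σT σr : ℝ → ℝ)
    (hσT : ContinuousOn σT (Set.Icc xL xR)) (hσT_pos : ∀ x ∈ Set.Icc xL xR, 0 < σT x)
    (hσr : ContinuousOn σr (Set.Icc xL xR))
    (hσr_pos : ∀ x ∈ Set.Icc xL xR, 0 < σr x ∧ σr x ≤ σT x)
    (A : ℝ → Lp ℝ 2 (transMeasure xL xR σT) →L[ℝ] Lp ℝ 2 (transMeasure xL xR σT))
    (hA : ∀ μ : ℝ, μ ∈ Set.Icc (-1 : ℝ) 1 → μ ≠ 0 →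
      ∀ φ : Lp ℝ 2 (transMeasure xL xR σT),
        ∀ᵐ x ∂(transMeasure xL xR σT),
          (A μ φ) x = ∫ y in Set.Icc xL xR, transKernel σT σr μ x y * φ y * σT y) :
    ∀ μ : ℝ, μ ∈ Set.Icc (-1 : ℝ) 1 → μ ≠ 0 →
      IsCompactOperator (A μ) ∧
      ∀ (ι : Type) (e : HilbertBasis ι ℝ (Lp ℝ 2 (transMeasure xL xR σT))),
        (Summable fun i => ‖A μ (e i)‖ ^ 2) ∧
        (Summable fun i => ‖ContinuousLinearMap.adjoint (A μ) (e i)‖ ^ 2) ∧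
        (∑' i, ‖A μ (e i)‖ ^ 2)
          = ∫ x in Set.Icc xL xR, (∫ y in Set.Icc xL xR,
              (transKernel σT σr μ x y) ^ 2 * σT x * σT y) ∧
        (∑' i, ‖ContinuousLinearMap.adjoint (A μ) (e i)‖ ^ 2) = (∑' i, ‖A μ (e i)‖ ^ 2) ∧
        (∑' i, ‖A μ (e i)‖ ^ 2)
          ≤ (1 / |μ|) * (xR - xL) * (sSup (σT '' Set.Icc xL xR)) ^ 2
              * sSup ((fun x => (σT x)⁻¹) '' Set.Icc xL xR) := by
  intro μ hμ hμ0
  let ν := transMeasure xL xR σT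
  -- continuous extensions of the coefficients
  let s : ℝ → ℝ := Set.IccExtend hx.le (Set.domRestrict (Set.Icc xL xR) σT)
  let r : ℝ → ℝ := Set.IccExtend hx.le (Set.domRestrict (Set.Icc xL xR) σr)
  have hs : Continuous s := (continuousOn_iff_continuous_domRestrict.1 hσT).Icc_extend'
  have hr : Continuous r := (continuousOn_iff_continuous_domRestrict.1 hσr).Icc_extend'
  have hsT : ∀ x ∈ Set.Icc xL xR, s x = σT x := fun x h => Set.IccExtend_of_mem _ _ h
  have hrr : ∀ x ∈ Set.Icc xL xR, r x = σr x := fun x h => Set.IccExtend_of_mem _ _ h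
  have hs0 : ∀ x, 0 < s x := fun x => hσT_pos _ (Set.projIcc xL xR hx.le x).2
  have hr0 : ∀ x, 0 < r x ∧ r x ≤ s x := fun x => hσr_pos _ (Set.projIcc xL xR hx.le x).2
  let K : ℝ → ℝ → ℝ := transKernel s r μ
  have hKeq : ∀ x ∈ Set.Icc xL xR, ∀ y ∈ Set.Icc xL xR, transKernel σT σr μ x y = K x y := by
    intro x hx' y hy'
    have hI : ∀ u ∈ Set.Icc xL xR, ∀ v ∈ Set.Icc xL xR, ∫ z in u..v, σT z = ∫ z in u..v, s z := by
      intro u hu v hv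
      refine intervalIntegral.integral_congr fun z hz => ?_
      exact (hsT z (Set.uIcc_subset_Icc hu hv hz)).symm
    simp only [K, transKernel, hI x hx' y hy', hI y hy' x hx', hsT y hy', hrr y hy']
  have hint : ∀ f : ℝ → ℝ, ∫ x, f x ∂ν = ∫ x in Set.Icc xL xR, f x * σT x :=
    fun f => tr_integral_measure xL xR σT hσT hσT_pos f
  have hfin : IsFiniteMeasure ν :=
    isFiniteMeasure_withDensity_ofReal hσT.integrableOn_Icc.2
  have hmem : ∀ᵐ x ∂ν, x ∈ Set.Icc xL xR :=
    (withDensity_absolutelyContinuous _ _).ae_le (ae_restrict_mem measurableSet_Icc)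
  have hA' : ∀ φ : Lp ℝ 2 ν, ∀ᵐ x ∂ν, A μ φ x = ∫ y, K x y * φ y ∂ν := by
    intro φ
    filter_upwards [hA μ hμ hμ0 φ, hmem] with x h1 h2
    rw [h1, hint]
    refine setIntegral_congr_fun measurableSet_Icc fun y hy => ?_
    simp only [hKeq x h2 y hy]
  have hHS : ∀ {ι : Type} (e : HilbertBasis ι ℝ (Lp ℝ 2 ν)),
      HasSum (fun i => ‖A μ (e i)‖ ^ 2) (∫ x, ∫ y, K x y ^ 2 ∂ν ∂ν) := fun e =>
    tr_HS ν K (tr_kernel_meas s r hs hr μ) (1 / |μ|)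
      (tr_kernel_bound s r hs hs0 hr0 μ hμ0) (A μ) hA' e
  have hval : ∫ x, ∫ y, K x y ^ 2 ∂ν ∂ν = ∫ x in Set.Icc xL xR, (∫ y in Set.Icc xL xR,
      (transKernel σT σr μ x y) ^ 2 * σT x * σT y) := by
    rw [hint]
    refine setIntegral_congr_fun measurableSet_Icc fun x hx' => ?_
    simp only [hint]
    rw [← integral_mul_const]
    refine setIntegral_congr_fun measurableSet_Icc fun y hy => ?_
    simp only [hKeq x hx' y hy]
    ring
  have hbound : ∫ x, ∫ y, K x y ^ 2 ∂ν ∂ν ≤ (1 / |μ|) * (xR - xL) * (sSup (σT '' Set.Icc xL xR)) ^ 2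
      * sSup ((fun x => (σT x)⁻¹) '' Set.Icc xL xR) := by
    set M := sSup (σT '' Set.Icc xL xR)
    set N := sSup ((fun x => (σT x)⁻¹) '' Set.Icc xL xR)
    have hM : ∀ x ∈ Set.Icc xL xR, σT x ≤ M := fun x h =>
      le_csSup (isCompact_Icc.image_of_continuousOn hσT).bddAbove (Set.mem_image_of_mem _ h)
    have hN : ∀ x ∈ Set.Icc xL xR, (σT x)⁻¹ ≤ N := fun x h =>
      le_csSup (isCompact_Icc.image_of_continuousOn
        (hσT.inv₀ fun x hx => (hσT_pos x hx).ne')).bddAbove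
        (Set.mem_image_of_mem (fun x => (σT x)⁻¹) h)
    have hL : xL ∈ Set.Icc xL xR := Set.left_mem_Icc.2 hx.le
    have hM0 : 0 < M := (hσT_pos _ hL).trans_le (hM _ hL)
    have hMN : 1 ≤ M * N := by
      rw [← mul_inv_cancel₀ (hσT_pos _ hL).ne']
      exact mul_le_mul (hM _ hL) (hN _ hL) (inv_nonneg.2 (hσT_pos _ hL).le) hM0.le
    have hin : ∀ x ∈ Set.Icc xL xR, ∫ y, K x y ^ 2 ∂ν ≤ 1 / |μ| := by
      intro x hx'
      rw [hint]
      refine le_trans (le_of_eq ?_) (tr_inner_bound s r hs hr hs0 hr0 μ hμ0 xL xR x hx')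
      refine setIntegral_congr_fun measurableSet_Icc fun y hy => ?_
      simp only [hsT y hy, K]
    have hμp : 0 < 1 / |μ| := one_div_pos.2 (abs_pos.2 hμ0)
    have h1 : ∫ x, ∫ y, K x y ^ 2 ∂ν ∂ν ≤ ∫ x in Set.Icc xL xR, (1 / |μ|) * M := by
      rw [hint]
      refine integral_mono_of_nonneg ?_ (integrable_const _) ?_
      · filter_upwards [ae_restrict_mem measurableSet_Icc] with x hx'
        exact mul_nonneg (integral_nonneg fun y => sq_nonneg _) (hσT_pos x hx').le
      · filter_upwards [ae_restrict_mem measurableSet_Icc] with x hx'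
        exact mul_le_mul (hin x hx') (hM x hx') (hσT_pos x hx').le hμp.le
    refine h1.trans ?_
    rw [setIntegral_const, smul_eq_mul, Real.volume_real_Icc_of_le hx.le]
    have h2 : 0 ≤ (1 / |μ|) * (xR - xL) * M :=
      mul_nonneg (mul_nonneg hμp.le (by linarith)) hM0.le
    nlinarith
  refine ⟨?_, fun ι e => ?_⟩
  · obtain ⟨w, b, -⟩ := exists_hilbertBasis ℝ (Lp ℝ 2 ν)
    exact tr_compact b (A μ) (tr_HS ν K (tr_kernel_meas s r hs hr μ) (1 / |μ|)
      (tr_kernel_bound s r hs hs0 hr0 μ hμ0) (A μ) hA' b).summable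
  · have h1 := hHS e
    have h2 := tr_adjoint e (A μ) _ h1
    exact ⟨h1.summable, h2.summable, h1.tsum_eq.trans hval, h2.tsum_eq.trans h1.tsum_eq.symm,
      h1.tsum_eq.le.trans hbound⟩
end

section
/- Expected norm of a Rademacher sum of self-adjoint Hilbert–Schmidt operators (Lemma 4.6): let H be a separable Hilbert space, H_1,…,H_m fixed self-adjoint Hilbert–Schmidt operators on H, not all zero, and ε_1,…,ε_m independent Rademacher random variables. Then E_ε‖(1/m)Σ_{ℓ=1}^m ε_ℓ H_ℓ‖ ≤ sqrt(3 + 2·log( (Σ_{ℓ=1}^m tr(H_ℓ²)) / (Σ_{ℓ=1}^m ‖H_ℓ‖²) ))·( (1/m²)·Σ_{ℓ=1}^m ‖H_ℓ‖² )^{1/2}, where ‖·‖ is the operator norm; note tr(H_ℓ²)≥‖H_ℓ‖² so the argument of the logarithm is at least 1. -/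
open scoped RealInnerProductSpace

/-- The real sign `±1` associated with a Boolean. -/
def rsign (b : Bool) : ℝ := if b then 1 else -1

def oddProd (p : ℕ) : ℝ := ∏ k ∈ Finset.range p, (2 * (k:ℝ) + 1)

lemma oddProd_exp_le (p : ℕ) : oddProd (p+1) * Real.exp (p+1) ≤ (2*(p:ℝ)+5)^(p+1) := by
  induction p with
  | zero =>
    simp [oddProd]
    have := Real.exp_one_lt_d9
    linarith
  | succ p ih =>
    have hp : (0:ℝ) ≤ p := by positivity
    have e1 : oddProd (p+1+1) = oddProd (p+1) * (2*(p:ℝ)+3) := by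
      unfold oddProd
      rw [Finset.prod_range_succ]
      push_cast; ring
    have h1 := Real.le_log_one_add_of_nonneg (x := 2/(2*(p:ℝ)+5)) (by positivity)
    have h2 := Real.le_log_one_add_of_nonneg (x := 4/(2*(p:ℝ)+3)) (by positivity)
    have r1 : 2*(2/(2*(p:ℝ)+5)) / (2/(2*(p:ℝ)+5) + 2) = 1/(p+3) := by
      field_simp; ring
    have r2 : 2*(4/(2*(p:ℝ)+3)) / (4/(2*(p:ℝ)+3) + 2) = 4/(2*p+5) := by
      field_simp; ring
    have q1 : 1 + 2/(2*(p:ℝ)+5) = (2*p+7)/(2*p+5) := by field_simp; ring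
    have q2 : 1 + 4/(2*(p:ℝ)+3) = (2*p+7)/(2*p+3) := by field_simp; ring
    rw [r1, q1, Real.le_log_iff_exp_le (by positivity), le_div_iff₀ (by positivity)] at h1
    rw [r2, q2, Real.le_log_iff_exp_le (by positivity), le_div_iff₀ (by positivity)] at h2
    have h3 := pow_le_pow_left₀ (by positivity) h1 (p+1)
    rw [mul_pow, ← Real.exp_nat_mul] at h3
    have h4 : Real.exp 1 ≤ Real.exp (((p+1:ℕ):ℝ) * (1/((p:ℝ)+3))) * Real.exp (4/(2*p+5)) := by
      rw [← Real.exp_add]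
      apply Real.exp_le_exp.2
      push_cast
      rw [mul_one_div, div_add_div _ _ (by positivity) (by positivity), le_div_iff₀ (by positivity)]
      nlinarith
    have e2 : Real.exp (((p+1:ℕ):ℝ)+1) = Real.exp (p+1) * Real.exp 1 := by
      rw [← Real.exp_add]; push_cast; rfl
    rw [e1, e2]
    push_cast
    have e3 : (2*((p:ℝ)+1)+5) = 2*p+7 := by ring
    rw [e3]
    calc oddProd (p+1) * (2*(p:ℝ)+3) * (Real.exp (p+1) * Real.exp 1)
        = (oddProd (p+1) * Real.exp (p+1)) * ((2*(p:ℝ)+3) * Real.exp 1) := by ring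
      _ ≤ (2*(p:ℝ)+5)^(p+1) * ((2*(p:ℝ)+3) * (Real.exp (((p+1:ℕ):ℝ) * (1/((p:ℝ)+3))) * Real.exp (4/(2*p+5)))) := by gcongr
      _ = (Real.exp (((p+1:ℕ):ℝ) * (1/((p:ℝ)+3))) * (2*(p:ℝ)+5)^(p+1)) * (Real.exp (4/(2*p+5)) * (2*(p:ℝ)+3)) := by ring
      _ ≤ (2*(p:ℝ)+7)^(p+1) * (2*p+7) := by gcongr
      _ = (2*(p:ℝ)+7)^(p+1+1) := by ring

lemma exists_moment (r : ℝ) (hr : 1 ≤ r) :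
    ∃ p : ℕ, oddProd (p+1) * r ≤ (3 + 2 * Real.log r)^(p+1) := by
  have hL : 0 ≤ Real.log r := Real.log_nonneg hr
  obtain ⟨p, hp1, hp2⟩ : ∃ p : ℕ, (p:ℝ) ≤ Real.log r ∧ Real.log r ≤ p+1 :=
    ⟨⌊Real.log r⌋₊, Nat.floor_le hL, (Nat.lt_floor_add_one _).le⟩
  refine ⟨p, ?_⟩
  have hre : r = Real.exp (Real.log r) := (Real.exp_log (by linarith)).symm
  generalize Real.log r = x at *
  subst hre
  have hp : (0:ℝ) ≤ p := by positivity
  have h := oddProd_exp_le p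
  have k1 : 2*(p:ℝ)+5 ≤ (3+2*x) * Real.exp ((p+1-x)/(p+1)) := by
    have := Real.add_one_le_exp ((p+1-x)/((p:ℝ)+1))
    calc 2*(p:ℝ)+5 ≤ (3+2*x) * ((p+1-x)/((p:ℝ)+1) + 1) := by
          rw [div_add_one (by positivity), mul_div_assoc', le_div_iff₀ (by positivity)]
          nlinarith
      _ ≤ _ := by gcongr
  have k2 := pow_le_pow_left₀ (by positivity) k1 (p+1)
  rw [mul_pow, ← Real.exp_nat_mul] at k2
  have k3 : ((p+1:ℕ):ℝ) * ((p+1-x)/((p:ℝ)+1)) = (p+1) - x := by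
    push_cast; field_simp
  rw [k3, Real.exp_sub, mul_div_assoc', le_div_iff₀ (Real.exp_pos _)] at k2
  have h5 : oddProd (p+1) * Real.exp x * Real.exp (p+1) ≤ (3+2*x)^(p+1) * Real.exp (p+1) := by
    refine le_trans ?_ k2
    rw [mul_right_comm]
    gcongr
  exact le_of_mul_le_mul_right h5 (Real.exp_pos _)

lemma scalar_ineq (n : ℕ) (hn : Even n) (a b : ℝ) :
    2 * ((a-b)*(a^(n+1) - b^(n+1))) ≤ (n+1) * ((a-b)^2*(a^n+b^n)) := by
  have key : ∀ q ∈ Finset.range (n+1), a^q*b^(n-q) + a^(n-q)*b^q ≤ a^n+b^n := by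
    intro q hq
    have hq' : q ≤ n := by simpa [Nat.lt_succ_iff] using hq
    have ha : |a|^n = a^n := hn.pow_abs a
    have hb : |b|^n = b^n := hn.pow_abs b
    have h1 : a^q*b^(n-q) ≤ |a|^q*|b|^(n-q) := by
      rw [← abs_pow, ← abs_pow, ← abs_mul]; exact le_abs_self _
    have h2 : a^(n-q)*b^q ≤ |a|^(n-q)*|b|^q := by
      rw [← abs_pow, ← abs_pow, ← abs_mul]; exact le_abs_self _
    have ha2 : |a|^n = |a|^q * |a|^(n-q) := by rw [← pow_add]; congr 1; omega
    have hb2 : |b|^n = |b|^q * |b|^(n-q) := by rw [← pow_add]; congr 1; omega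
    rw [← ha, ← hb, ha2, hb2]
    have h3 : 0 ≤ (|a|^q - |b|^q)*(|a|^(n-q)-|b|^(n-q)) := by
      rcases le_total |a| |b| with h | h
      · apply mul_nonneg_of_nonpos_of_nonpos <;> rw [sub_nonpos] <;> gcongr
      · apply mul_nonneg <;> rw [sub_nonneg] <;> gcongr
    linarith
  have hs := Finset.sum_le_sum key
  rw [Finset.sum_add_distrib, Finset.sum_const, Finset.card_range, nsmul_eq_mul] at hs
  have g1 : (∑ i ∈ Finset.range (n+1), a^i*b^(n-i)) * (a-b) = a^(n+1)-b^(n+1) := by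
    have := (Commute.all a b).geom_sum₂_mul (n+1)
    simpa using this
  have g2 : (∑ i ∈ Finset.range (n+1), a^(n-i)*b^i) * (a-b) = a^(n+1)-b^(n+1) := by
    have := (Commute.all b a).geom_sum₂_mul (n+1)
    have h' : ∑ i ∈ Finset.range (n+1), a^(n-i)*b^i = ∑ i ∈ Finset.range (n+1), b^i*a^(n+1-1-i) := 
      Finset.sum_congr rfl (fun i _ => by simp [mul_comm])
    rw [h']; linear_combination -this
  push_cast at hs
  have := mul_le_mul_of_nonneg_left hs (sq_nonneg (a-b))
  linear_combination this - (a-b)*g1 - (a-b)*g2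


set_option linter.unusedSectionVars false

section mat
open Matrix
variable {d : Type*} [Fintype d] [DecidableEq d]

lemma herm_decomp (A : Matrix d d ℝ) (hA : A.IsHermitian) :
    ∃ (U : Matrix d d ℝ) (a : d → ℝ), U * Uᵀ = 1 ∧ Uᵀ * U = 1 ∧
      ∀ n : ℕ, A ^ n = U * diagonal (fun j => a j ^ n) * Uᵀ := by
  have h1 : (hA.eigenvectorUnitary : Matrix d d ℝ) * (hA.eigenvectorUnitary : Matrix d d ℝ)ᵀ = 1 := by
    have := Unitary.mul_star_self_of_mem hA.eigenvectorUnitary.2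
    simpa [star_eq_conjTranspose] using this
  have h2 : (hA.eigenvectorUnitary : Matrix d d ℝ)ᵀ * (hA.eigenvectorUnitary : Matrix d d ℝ) = 1 := by
    have := Unitary.star_mul_self_of_mem hA.eigenvectorUnitary.2
    simpa [star_eq_conjTranspose] using this
  refine ⟨hA.eigenvectorUnitary, hA.eigenvalues, h1, h2, ?_⟩
  have h0 : A = hA.eigenvectorUnitary * diagonal hA.eigenvalues * (hA.eigenvectorUnitary : Matrix d d ℝ)ᵀ := by
    have := hA.spectral_theorem
    simp only [Unitary.conjStarAlgAut_apply] at this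
    simpa [star_eq_conjTranspose, Function.comp_def] using this
  generalize (hA.eigenvectorUnitary : Matrix d d ℝ) = U at *
  generalize hA.eigenvalues = a at *
  intro n
  induction n with
  | zero => simp [h1]
  | succ n ih =>
    rw [pow_succ, ih]
    conv_lhs => rw [h0]
    have : U * diagonal (fun j => a j ^ n) * Uᵀ * (U * diagonal a * Uᵀ)
        = U * diagonal (fun j => a j ^ n) * (Uᵀ * U) * diagonal a * Uᵀ := by
      simp only [Matrix.mul_assoc]
    rw [this, h2, Matrix.mul_one, Matrix.mul_assoc U, diagonal_mul_diagonal]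
    simp only [pow_succ]

lemma trace_conj_pair (U V : Matrix d d ℝ) (f g : d → ℝ) :
    trace ((U * diagonal f * Uᵀ) * (V * diagonal g * Vᵀ)) =
      ∑ j, ∑ k, ((Uᵀ * V) j k)^2 * (f j * g k) := by
  have : trace ((U * diagonal f * Uᵀ) * (V * diagonal g * Vᵀ))
      = trace ((diagonal f * (Uᵀ * V)) * (diagonal g * (Uᵀ * V)ᵀ)) := by
    rw [transpose_mul, transpose_transpose, Matrix.mul_assoc U, Matrix.mul_assoc U, trace_mul_comm U]
    simp only [Matrix.mul_assoc]
  rw [this]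
  generalize Uᵀ * V = W
  simp only [trace, diag, mul_apply (M := diagonal f * W), diagonal_mul, transpose_apply]
  refine Finset.sum_congr rfl fun j _ => Finset.sum_congr rfl fun k _ => by ring

lemma trace_klein (n : ℕ) (hn : Even n) (A B : Matrix d d ℝ) (hA : A.IsHermitian) (hB : B.IsHermitian) :
    2 * trace ((A - B) * (A^(n+1) - B^(n+1))) ≤ (n+1) * trace ((A-B)^2 * (A^n + B^n)) := by
  obtain ⟨U, a, -, -, ha⟩ := herm_decomp A hA
  obtain ⟨V, b, -, -, hb⟩ := herm_decomp B hB
  have key : ∀ i j : ℕ, trace (A^i * B^j) = ∑ x, ∑ y, ((Uᵀ * V) x y)^2 * (a x ^ i * b y ^ j) := by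
    intro i j
    rw [ha, hb, trace_conj_pair]
  have key' : ∀ i j : ℕ, trace (B^j * A^i) = ∑ x, ∑ y, ((Uᵀ * V) x y)^2 * (a x ^ i * b y ^ j) := by
    intro i j; rw [trace_mul_comm, key]
  have e1 : trace ((A - B) * (A^(n+1) - B^(n+1))) =
      trace (A^(n+2) * B^0) - trace (A^1 * B^(n+1)) - trace (A^(n+1) * B^1) + trace (A^0 * B^(n+2)) := by
    rw [sub_mul, mul_sub, mul_sub, ← pow_succ', ← pow_succ', trace_sub, trace_sub, trace_sub,
      trace_mul_comm B]
    simp only [pow_one, pow_zero, mul_one, one_mul]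
    ring
  have e2 : trace ((A-B)^2 * (A^n + B^n)) =
      trace (A^(n+2) * B^0) - 2 * trace (A^(n+1) * B^1) + trace (A^n * B^2)
      + trace (A^2 * B^n) - 2 * trace (A^1 * B^(n+1)) + trace (A^0 * B^(n+2)) := by
    have x1 : trace (A * B * A^n) = trace (A^(n+1) * B) := by
      rw [trace_mul_comm, ← Matrix.mul_assoc, ← pow_succ]
    have x2 : trace (B * A * A^n) = trace (A^(n+1) * B) := by
      rw [Matrix.mul_assoc, ← pow_succ', trace_mul_comm]
    have x3 : trace (A * B * B^n) = trace (A * B^(n+1)) := by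
      rw [Matrix.mul_assoc, ← pow_succ']
    have x4 : trace (B * A * B^n) = trace (A * B^(n+1)) := by
      rw [trace_mul_comm, ← Matrix.mul_assoc, ← pow_succ, trace_mul_comm]
    have x5 : trace (B * B * A^n) = trace (A^n * B^2) := by
      rw [trace_mul_comm, pow_two]
    have x6 : A * A * A^n = A^(n+2) := by rw [← pow_two, ← pow_add, add_comm]
    have x7 : B * B * B^n = B^(n+2) := by rw [← pow_two, ← pow_add, add_comm]
    rw [pow_two (A - B)]
    simp only [sub_mul, mul_sub, mul_add, trace_sub, trace_add, x1, x2, x3, x4, x5, x6, x7]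
    simp only [pow_one, pow_zero, mul_one, one_mul, pow_two A]
    ring
  rw [e1, e2]
  simp only [key, Finset.mul_sum, ← Finset.sum_add_distrib, ← Finset.sum_sub_distrib]
  refine Finset.sum_le_sum fun x _ => Finset.sum_le_sum fun y _ => ?_
  have := mul_le_mul_of_nonneg_left (scalar_ineq n hn (a x) (b y)) (sq_nonneg ((Uᵀ * V) x y))
  refine le_trans (le_of_eq ?_) (this.trans (le_of_eq ?_)) <;> ring

lemma trace_contr (A Y : Matrix d d ℝ) (hA : A.IsHermitian) (hY : Y.IsHermitian) (c : ℝ)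
    (h : ∀ x : d → ℝ, (A *ᵥ x) ⬝ᵥ (A *ᵥ x) ≤ c * (x ⬝ᵥ x)) :
    trace (A^2 * Y^2) ≤ c * trace (Y^2) := by
  have hA' : Aᵀ = A := by have := hA.eq; rwa [conjTranspose_eq_transpose_of_trivial] at this
  have hY' : Yᵀ = Y := by have := hY.eq; rwa [conjTranspose_eq_transpose_of_trivial] at this
  have gen : ∀ M : Matrix d d ℝ, trace (Mᵀ * M) = ∑ j, (fun i => M i j) ⬝ᵥ (fun i => M i j) := by
    intro M; simp [trace, mul_apply, dotProduct]
  have e1 : A^2 * Y^2 = A * A * Y * Y := by simp [pow_two, Matrix.mul_assoc]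
  have e2 : trace (A^2*Y^2) = trace ((A*Y)ᵀ * (A * Y)) := by
    rw [e1, transpose_mul, hA', hY', trace_mul_comm]; simp only [Matrix.mul_assoc]
  have e3 : Y^2 = Yᵀ * Y := by rw [hY', pow_two]
  rw [e2, e3, gen, gen, Finset.mul_sum]
  exact Finset.sum_le_sum fun j _ => h (fun i => Y i j)

lemma bilin_pow_le (A : Matrix d d ℝ) (hA : A.IsHermitian) (p : ℕ) (x y : d → ℝ)
    (hx : x ⬝ᵥ x ≤ 1) (hy : y ⬝ᵥ y ≤ 1) :
    (y ⬝ᵥ (A *ᵥ x))^(2*(p+1)) ≤ trace (A^(2*(p+1))) := by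
  obtain ⟨U, a, h1, h2, ha⟩ := herm_decomp A hA
  have iso : ∀ z : d → ℝ, (Uᵀ *ᵥ z) ⬝ᵥ (Uᵀ *ᵥ z) = z ⬝ᵥ z := by
    intro z
    rw [dotProduct_mulVec, vecMul_transpose, mulVec_mulVec, h1, one_mulVec]
  have hA1 : A = U * diagonal a * Uᵀ := by simpa using ha 1
  have e1 : y ⬝ᵥ (A *ᵥ x) = ∑ j, (Uᵀ *ᵥ y) j * (a j * (Uᵀ *ᵥ x) j) := by
    conv_lhs => rw [hA1]
    rw [← mulVec_mulVec, ← mulVec_mulVec, dotProduct_mulVec, ← mulVec_transpose]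
    simp [dotProduct, mulVec_diagonal]
  have tr : trace (A^(2*(p+1))) = ∑ j, a j^(2*(p+1)) := by
    rw [ha, trace_mul_comm, ← Matrix.mul_assoc, h2, Matrix.one_mul, trace_diagonal]
  rw [e1, tr]
  rw [← iso] at hx hy
  generalize Uᵀ *ᵥ x = u at *
  generalize Uᵀ *ᵥ y = v at *
  rcases isEmpty_or_nonempty d with hd | hd
  · simp
  obtain ⟨j0, -, hj0⟩ := Finset.exists_max_image Finset.univ (fun j => a j ^ 2) Finset.univ_nonempty
  have cs := Finset.sum_mul_sq_le_sq_mul_sq Finset.univ v (fun j => a j * u j)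
  have b1 : ∑ j, (a j * u j)^2 ≤ a j0^2 := by
    calc ∑ j, (a j * u j)^2 ≤ ∑ j, a j0 ^2 * (u j * u j) := by
          refine Finset.sum_le_sum fun j hj => ?_
          have := mul_le_mul_of_nonneg_right (hj0 j hj) (mul_self_nonneg (u j))
          nlinarith
      _ = a j0 ^2 * (u ⬝ᵥ u) := by rw [← Finset.mul_sum]; rfl
      _ ≤ a j0^2 := mul_le_of_le_one_right (sq_nonneg _) hx
  have b2 : ∑ j, v j^2 ≤ 1 := by simpa [dotProduct, pow_two] using hy
  have b3 : (∑ j, v j * (a j * u j))^2 ≤ a j0^2 := by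
    refine cs.trans ?_
    calc _ ≤ 1 * a j0^2 := by gcongr
      _ = _ := one_mul _
  calc _ ≤ a j0^(2*(p+1)) := by
        rw [pow_mul, pow_mul]; gcongr
    _ ≤ _ := Finset.single_le_sum (f := fun j => a j^(2*(p+1))) (fun j _ => by rw [pow_mul]; positivity) (Finset.mem_univ j0)

def flipAt {m : ℕ} (l : Fin m) (s : Fin m → Bool) : Fin m → Bool := Function.update s l (!(s l))

lemma flipAt_invol {m : ℕ} (l : Fin m) : Function.Involutive (flipAt l) := by
  intro s; simp [flipAt]

lemma sum_flip {m : ℕ} (l : Fin m) (f : (Fin m → Bool) → ℝ) : ∑ s, f (flipAt l s) = ∑ s, f s :=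
  Equiv.sum_comp ((flipAt_invol l).toPerm) f

def radSum {m : ℕ} (A : Fin m → Matrix d d ℝ) (s : Fin m → Bool) : Matrix d d ℝ :=
  ∑ l, rsign (s l) • A l

lemma radSum_herm {m : ℕ} (A : Fin m → Matrix d d ℝ) (hA : ∀ l, (A l).IsHermitian) (s : Fin m → Bool) :
    (radSum A s).IsHermitian := by
  unfold radSum Matrix.IsHermitian
  rw [conjTranspose_sum]
  refine Finset.sum_congr rfl fun l _ => ?_
  rw [conjTranspose_smul, (hA l).eq]; simp

lemma rsign_sq (b : Bool) : rsign b * rsign b = 1 := by cases b <;> simp [rsign]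
lemma rsign_not (b : Bool) : rsign (!b) = - rsign b := by cases b <;> simp [rsign]

lemma radSum_flip {m : ℕ} (A : Fin m → Matrix d d ℝ) (s : Fin m → Bool) (l : Fin m) :
    radSum A s - radSum A (flipAt l s) = (2 * rsign (s l)) • A l := by
  unfold radSum
  rw [← Finset.sum_sub_distrib, Finset.sum_eq_single l]
  · rw [← sub_smul]; simp [flipAt, rsign_not]; congr 1; ring
  · intro k _ hk; simp [flipAt, hk]
  · simp

lemma moment_step {m : ℕ} (A : Fin m → Matrix d d ℝ) (hA : ∀ l, (A l).IsHermitian) (p : ℕ) :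
    ∑ s, trace (radSum A s ^ (2*(p+1))) ≤
      (2*(p:ℝ)+1) * ∑ l, ∑ s, trace (A l ^2 * radSum A s ^(2*p)) := by
  have e : ∀ s, trace (radSum A s ^ (2*(p+1))) =
      ∑ l, rsign (s l) * trace (A l * radSum A s ^ (2*p+1)) := by
    intro s
    rw [show 2*(p+1) = (2*p+1)+1 by ring, pow_succ']
    conv_lhs => enter [1,1]; rw [radSum]
    rw [Finset.sum_mul, trace_sum]
    refine Finset.sum_congr rfl fun l _ => ?_
    rw [smul_mul_assoc, trace_smul, smul_eq_mul]
  simp only [e]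
  rw [Finset.sum_comm, Finset.mul_sum]
  refine Finset.sum_le_sum fun l _ => ?_
  set f := fun s => rsign (s l) * trace (A l * radSum A s ^ (2*p+1)) with hf
  set g := fun s => trace (A l ^2 * radSum A s ^(2*p)) with hg
  have key : ∀ s, f s + f (flipAt l s) ≤ (2*(p:ℝ)+1) * (g s + g (flipAt l s)) := by
    intro s
    have k := trace_klein (2*p) (even_two_mul p) (radSum A s) (radSum A (flipAt l s))
      (radSum_herm A hA s) (radSum_herm A hA _)
    rw [radSum_flip, smul_pow, smul_mul_assoc, smul_mul_assoc, trace_smul, trace_smul, smul_eq_mul,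
      smul_eq_mul, mul_sub, trace_sub, mul_add, trace_add] at k
    have h1 : rsign (flipAt l s l) = - rsign (s l) := by simp [flipAt, rsign_not]
    have h2 : (2 * rsign (s l))^2 = 4 := by linear_combination 4 * rsign_sq (s l)
    rw [h2] at k
    push_cast at k
    simp only [hf, hg, h1]
    linarith
  have := Finset.sum_le_sum fun s (_ : s ∈ Finset.univ) => key s
  rw [Finset.sum_add_distrib, ← Finset.mul_sum, Finset.sum_add_distrib, sum_flip, sum_flip] at this
  linarith

lemma moment_bound {m : ℕ} (A : Fin m → Matrix d d ℝ) (hA : ∀ l, (A l).IsHermitian) (c : Fin m → ℝ)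
    (hc0 : ∀ l, 0 ≤ c l)
    (hc : ∀ l, ∀ x : d → ℝ, (A l *ᵥ x) ⬝ᵥ (A l *ᵥ x) ≤ c l * (x ⬝ᵥ x)) (T : ℝ)
    (hT : ∑ l, trace (A l ^2) ≤ T) (p : ℕ) :
    ∑ s, trace (radSum A s ^ (2*(p+1))) ≤ 2^m * (oddProd (p+1) * (∑ l, c l)^p * T) := by
  induction p with
  | zero =>
    refine (moment_step A hA 0).trans ?_
    simp [oddProd, ← Finset.mul_sum]
    exact hT
  | succ p ih =>
    refine (moment_step A hA (p+1)).trans ?_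
    have e1 : oddProd (p+1+1) = oddProd (p+1) * (2*((p+1:ℕ):ℝ)+1) := by
      unfold oddProd
      rw [Finset.prod_range_succ]
    calc _ ≤ (2*((p+1:ℕ):ℝ)+1) * ∑ l, ∑ s, c l * trace (radSum A s ^(2*(p+1))) := by
          gcongr with l _ s _
          rw [mul_comm 2 (p+1), pow_mul]
          exact trace_contr _ _ (hA l) ((radSum_herm A hA s).pow _) _ (hc l)
      _ = (2*((p+1:ℕ):ℝ)+1) * ((∑ l, c l) * ∑ s, trace (radSum A s ^(2*(p+1)))) := by
          simp only [← Finset.mul_sum, ← Finset.sum_mul]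
      _ ≤ (2*((p+1:ℕ):ℝ)+1) * ((∑ l, c l) * (2^m * (oddProd (p+1) * (∑ l, c l)^p * T))) := by
          have := Finset.sum_nonneg fun l (_ : l ∈ Finset.univ) => hc0 l
          gcongr
      _ = _ := by rw [e1]; ring

end mat

section hilb
open Matrix Filter Topology
variable {H : Type*} [NormedAddCommGroup H] [InnerProductSpace ℝ H] [CompleteSpace H]
    {ι : Type*} (e : HilbertBasis ι ℝ H)

noncomputable def projF (F : Finset ι) (x : H) : H := ∑ i ∈ F, (inner ℝ (e i) x) • e i

lemma projF_tendsto (x : H) : Tendsto (fun F => projF e F x) atTop (𝓝 x) := by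
  have := e.hasSum_repr x
  simp only [HilbertBasis.repr_apply_apply] at this
  exact this

noncomputable def matF (F : Finset ι) (A : H →L[ℝ] H) : Matrix F F ℝ := fun i j => inner ℝ (e i) (A (e j))

lemma matF_herm (F : Finset ι) (A : H →L[ℝ] H) (hA : IsSelfAdjoint A) : (matF e F A).IsHermitian := by
  ext i j
  simp only [conjTranspose_apply, matF, star_trivial]
  rw [real_inner_comm, ← ContinuousLinearMap.adjoint_inner_right, hA.adjoint_eq]

lemma matF_mulVec (F : Finset ι) (A : H →L[ℝ] H) (v : F → ℝ) (i : F) :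
    (matF e F A *ᵥ v) i = inner ℝ (e i) (A (∑ j : F, v j • e j)) := by
  simp [mulVec, dotProduct, matF, inner_sum, inner_smul_right, mul_comm]

lemma norm_comb (F : Finset ι) (v : F → ℝ) : ‖∑ j : F, v j • e j‖^2 = v ⬝ᵥ v := by
  have ho : Orthonormal ℝ (fun j : F => e j) := e.orthonormal.comp _ Subtype.val_injective
  rw [← real_inner_self_eq_norm_sq, ho.inner_sum]
  simp [dotProduct]

lemma matF_contr (F : Finset ι) (A : H →L[ℝ] H) (v : F → ℝ) :
    (matF e F A *ᵥ v) ⬝ᵥ (matF e F A *ᵥ v) ≤ ‖A‖^2 * (v ⬝ᵥ v) := by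
  have ho : Orthonormal ℝ (fun j : F => e j) := e.orthonormal.comp _ Subtype.val_injective
  rw [← norm_comb e F v, ← mul_pow]
  have h1 := ho.sum_inner_products_le (A (∑ j : F, v j • e j)) (s := Finset.univ)
  have h2 : ‖A (∑ j : F, v j • e j)‖^2 ≤ (‖A‖ * ‖∑ j : F, v j • e j‖)^2 := by
    gcongr; exact A.le_opNorm _
  refine le_trans (le_of_eq ?_) (h1.trans h2)
  simp only [dotProduct, matF_mulVec, Real.norm_eq_abs, pow_two, abs_mul_abs_self]

lemma matF_trace (F : Finset ι) [DecidableEq F] (A : H →L[ℝ] H) (hA : IsSelfAdjoint A)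
    (hS : Summable fun i => ‖A (e i)‖ ^ 2) :
    trace (matF e F A ^ 2) ≤ ∑' i, ‖A (e i)‖ ^ 2 := by
  have ho : Orthonormal ℝ (fun j : F => e j) := e.orthonormal.comp _ Subtype.val_injective
  have hsym : ∀ i j, matF e F A i j = matF e F A j i := fun i j => by
    have := congrFun (congrFun (matF_herm e F A hA).eq i) j
    simpa using this.symm
  have e1 : trace (matF e F A ^ 2) = ∑ j : F, ∑ i : F, ‖inner ℝ (e i) (A (e j))‖^2 := by
    rw [pow_two, trace]
    refine Finset.sum_congr rfl fun j _ => ?_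
    rw [diag, mul_apply]
    refine Finset.sum_congr rfl fun i _ => ?_
    rw [hsym j i]
    simp [matF, pow_two]
  rw [e1]
  calc _ ≤ ∑ j : F, ‖A (e j)‖^2 := Finset.sum_le_sum fun j _ => ho.sum_inner_products_le _
    _ = ∑ j ∈ F, ‖A (e j)‖^2 := Finset.sum_coe_sort F (fun j => ‖A (e j)‖^2)
    _ ≤ _ := hS.sum_le_tsum _ (fun _ _ => by positivity)

lemma hilb_bilin {m : ℕ} (Hop : Fin m → H →L[ℝ] H)
    (hsa : ∀ ℓ, IsSelfAdjoint (Hop ℓ))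
    (hHS : ∀ ℓ, Summable fun i => ‖Hop ℓ (e i)‖ ^ 2) (p : ℕ)
    (x y : (Fin m → Bool) → H) (hx : ∀ s, ‖x s‖ ≤ 1) (hy : ∀ s, ‖y s‖ ≤ 1) :
    ∑ s, (inner ℝ (y s) ((∑ ℓ, rsign (s ℓ) • Hop ℓ) (x s)))^(2*(p+1)) ≤
      2^m * (oddProd (p+1) * (∑ l, ‖Hop l‖^2)^p * ∑ ℓ, ∑' i, ‖Hop ℓ (e i)‖ ^ 2) := by
  classical
  have lim : Tendsto (fun F => ∑ s, (inner ℝ (projF e F (y s)) ((∑ ℓ, rsign (s ℓ) • Hop ℓ) (projF e F (x s))))^(2*(p+1)))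
      atTop (𝓝 (∑ s, (inner ℝ (y s) ((∑ ℓ, rsign (s ℓ) • Hop ℓ) (x s)))^(2*(p+1)))) := by
    refine tendsto_finsetSum _ fun s _ => ?_
    refine Tendsto.pow ?_ _
    refine Tendsto.inner (projF_tendsto e _) ?_
    exact ((ContinuousLinearMap.continuous _).tendsto _).comp (projF_tendsto e _)
  refine le_of_tendsto' lim fun F => ?_
  have ho : Orthonormal ℝ (fun j : F => e j) := e.orthonormal.comp _ Subtype.val_injective
  have hh : ∀ l, (matF e F (Hop l)).IsHermitian := fun l => matF_herm e F _ (hsa l)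
  refine le_trans ?_ (moment_bound (fun l => matF e F (Hop l)) hh (fun l => ‖Hop l‖^2)
    (fun l => by positivity) (fun l v => matF_contr e F _ v) _
    (Finset.sum_le_sum fun l _ => matF_trace e F _ (hsa l) (hHS l)) p)
  refine Finset.sum_le_sum fun s _ => ?_
  have hcoef : ∀ z : H, ‖z‖ ≤ 1 → (fun i : F => inner ℝ (e i) z) ⬝ᵥ (fun i : F => inner ℝ (e i) z) ≤ 1 := by
    intro z hz
    have h1 := ho.sum_inner_products_le z (s := Finset.univ)
    have h2 : ‖z‖^2 ≤ 1 := pow_le_one₀ (norm_nonneg _) hz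
    refine le_trans (le_of_eq ?_) (h1.trans h2)
    simp [dotProduct, pow_two]
  refine le_trans (le_of_eq ?_) (bilin_pow_le _ (radSum_herm _ hh s) p _ _ (hcoef _ (hx s)) (hcoef _ (hy s)))
  congr 1
  have e1 : radSum (fun l => matF e F (Hop l)) s = matF e F (∑ ℓ, rsign (s ℓ) • Hop ℓ) := by
    ext i j
    simp [radSum, matF, Matrix.sum_apply, inner_sum, inner_smul_right]
  have e2 : ∀ z, projF e F z = ∑ j : F, (inner ℝ (e j) z) • e j := fun z =>
    (Finset.sum_coe_sort F (fun j => (inner ℝ (e j) z : ℝ) • e j)).symm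
  rw [e1, e2, e2]
  simp only [dotProduct, matF_mulVec]
  rw [sum_inner]
  simp [inner_smul_left]

lemma hilb_norm {m : ℕ} (Hop : Fin m → H →L[ℝ] H)
    (hsa : ∀ ℓ, IsSelfAdjoint (Hop ℓ))
    (hHS : ∀ ℓ, Summable fun i => ‖Hop ℓ (e i)‖ ^ 2) (p : ℕ) :
    ∑ s : Fin m → Bool, ‖∑ ℓ, rsign (s ℓ) • Hop ℓ‖^(2*(p+1)) ≤
      2^m * (oddProd (p+1) * (∑ l, ‖Hop l‖^2)^p * ∑ ℓ, ∑' i, ‖Hop ℓ (e i)‖ ^ 2) := by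
  have ex : ∀ (B : H →L[ℝ] H) (n : ℕ), ∃ x, ‖x‖ ≤ 1 ∧ ‖B‖ - 1/((n:ℝ)+1) ≤ ‖B x‖ := by
    intro B n
    obtain ⟨x, h1, h2⟩ := B.exists_lt_apply_of_lt_opNorm (r := ‖B‖ - 1/((n:ℝ)+1))
      (by have : 0 < 1/((n:ℝ)+1) := by positivity
          linarith)
    exact ⟨x, h1.le, h2.le⟩
  choose X hX1 hX2 using ex
  have lim1 : ∀ B : H →L[ℝ] H, Tendsto (fun n => ‖B (X B n)‖) atTop (𝓝 ‖B‖) := by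
    intro B
    have h0 : Tendsto (fun n : ℕ => ‖B‖ - 1/((n:ℝ)+1)) atTop (𝓝 ‖B‖) := by
      simpa using (tendsto_const_nhds (x := ‖B‖)).sub (tendsto_one_div_add_atTop_nhds_zero_nat (𝕜 := ℝ))
    refine tendsto_of_tendsto_of_tendsto_of_le_of_le h0 tendsto_const_nhds (hX2 B) fun n => ?_
    exact (B.le_opNorm _).trans (mul_le_of_le_one_right (norm_nonneg _) (hX1 B n))
  have lim : Tendsto (fun n => ∑ s : Fin m → Bool, ‖(∑ ℓ, rsign (s ℓ) • Hop ℓ) (X (∑ ℓ, rsign (s ℓ) • Hop ℓ) n)‖^(2*(p+1)))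
      atTop (𝓝 (∑ s : Fin m → Bool, ‖∑ ℓ, rsign (s ℓ) • Hop ℓ‖^(2*(p+1)))) :=
    tendsto_finsetSum _ fun s _ => (lim1 _).pow _
  refine le_of_tendsto' lim fun n => ?_
  refine le_trans (le_of_eq ?_) (hilb_bilin e Hop hsa hHS p (fun s => X (∑ ℓ, rsign (s ℓ) • Hop ℓ) n)
    (fun s => ‖(∑ ℓ, rsign (s ℓ) • Hop ℓ) (X (∑ ℓ, rsign (s ℓ) • Hop ℓ) n)‖⁻¹ •
      (∑ ℓ, rsign (s ℓ) • Hop ℓ) (X (∑ ℓ, rsign (s ℓ) • Hop ℓ) n)) (fun s => hX1 _ _) (fun s => ?_))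
  · refine Finset.sum_congr rfl fun s _ => ?_
    generalize (∑ ℓ, rsign (s ℓ) • Hop ℓ) (X (∑ ℓ, rsign (s ℓ) • Hop ℓ) n) = z
    congr 1
    rw [real_inner_smul_left, real_inner_self_eq_norm_sq]
    rcases eq_or_ne ‖z‖ 0 with h | h
    · simp [h]
    · field_simp
  · rw [norm_smul, norm_inv, norm_norm]
    exact inv_mul_le_one

lemma norm_sq_le_hs (A : H →L[ℝ] H) (hA : IsSelfAdjoint A)
    (hS : Summable fun i => ‖A (e i)‖ ^ 2) : ‖A‖^2 ≤ ∑' i, ‖A (e i)‖ ^ 2 := by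
  have hT : 0 ≤ ∑' i, ‖A (e i)‖ ^ 2 := tsum_nonneg fun i => by positivity
  have : ‖A‖ ≤ Real.sqrt (∑' i, ‖A (e i)‖ ^ 2) := by
    refine A.opNorm_le_bound (Real.sqrt_nonneg _) fun x => ?_
    refine le_of_pow_le_pow_left₀ two_ne_zero (by positivity) ?_
    rw [mul_pow, Real.sq_sqrt hT, ← real_inner_self_eq_norm_sq]
    have h := e.hasSum_inner_mul_inner (A x) (A x)
    refine hasSum_le (fun i => ?_) h (hS.hasSum.mul_right (‖x‖^2))
    have : inner ℝ (A x) (e i) = inner ℝ x (A (e i)) := by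
      rw [← ContinuousLinearMap.adjoint_inner_right, hA.adjoint_eq]
    rw [real_inner_comm (A x) (e i), this, ← mul_pow, ← pow_two, ← sq_abs]
    have := abs_real_inner_le_norm x (A (e i))
    rw [mul_comm]
    gcongr
  calc _ ≤ (Real.sqrt (∑' i, ‖A (e i)‖ ^ 2))^2 := by gcongr
    _ = _ := Real.sq_sqrt hT

end hilb

/-- **Expected norm of a Rademacher sum of self-adjoint Hilbert–Schmidt operators**
(Lemma 4.6): for fixed self-adjoint Hilbert–Schmidt operators `H_1, …, H_m`, not all
zero, on a separable Hilbert space (with Hilbert basis `(e_i)`, so that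
`tr(H_ℓ²) = Σ_i ‖H_ℓ e_i‖²`), the expectation over independent Rademacher signs
`ε_1, …, ε_m` (written as the average over all `2^m` sign patterns) satisfies
`E_ε ‖(1/m) Σ_ℓ ε_ℓ H_ℓ‖ ≤ sqrt(3 + 2 log(Σ_ℓ tr(H_ℓ²) / Σ_ℓ ‖H_ℓ‖²)) ·
 sqrt((1/m²) Σ_ℓ ‖H_ℓ‖²)`. -/
theorem rademacher_sum_selfAdjoint_HS_expected_norm
    {H : Type*} [NormedAddCommGroup H] [InnerProductSpace ℝ H] [CompleteSpace H]
    {ι : Type*} [Countable ι] (e : HilbertBasis ι ℝ H)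
    (m : ℕ) (hm : 0 < m) (Hop : Fin m → H →L[ℝ] H)
    (hsa : ∀ ℓ, IsSelfAdjoint (Hop ℓ))
    (hHS : ∀ ℓ, Summable fun i => ‖Hop ℓ (e i)‖ ^ 2)
    (hnz : ∃ ℓ, Hop ℓ ≠ 0) :
    (∑ s : Fin m → Bool, ‖(m : ℝ)⁻¹ • ∑ ℓ, rsign (s ℓ) • Hop ℓ‖) / 2 ^ m
      ≤ Real.sqrt (3 + 2 * Real.log
          ((∑ ℓ, ∑' i, ‖Hop ℓ (e i)‖ ^ 2) / (∑ ℓ, ‖Hop ℓ‖ ^ 2)))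
        * Real.sqrt ((m : ℝ)⁻¹ ^ 2 * ∑ ℓ, ‖Hop ℓ‖ ^ 2) := by
  have hσ : 0 < ∑ ℓ, ‖Hop ℓ‖ ^ 2 := by
    obtain ⟨l, hl⟩ := hnz
    refine Finset.sum_pos' (fun _ _ => by positivity) ⟨l, Finset.mem_univ _, ?_⟩
    have := norm_pos_iff.2 hl
    positivity
  have hr : 1 ≤ (∑ ℓ, ∑' i, ‖Hop ℓ (e i)‖ ^ 2) / (∑ ℓ, ‖Hop ℓ‖ ^ 2) := by
    rw [one_le_div hσ]
    exact Finset.sum_le_sum fun l _ => norm_sq_le_hs e _ (hsa l) (hHS l)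
  obtain ⟨p, hp⟩ := exists_moment _ hr
  have hmom := hilb_norm e Hop hsa hHS p
  have hlog := Real.log_nonneg hr
  have hT : (∑ ℓ, ∑' i, ‖Hop ℓ (e i)‖ ^ 2) =
      ((∑ ℓ, ∑' i, ‖Hop ℓ (e i)‖ ^ 2) / (∑ ℓ, ‖Hop ℓ‖ ^ 2)) * (∑ ℓ, ‖Hop ℓ‖ ^ 2) := by
    field_simp
  rw [hT] at hmom
  generalize (∑ ℓ, ∑' i, ‖Hop ℓ (e i)‖ ^ 2) / (∑ ℓ, ‖Hop ℓ‖ ^ 2) = r at *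
  generalize (∑ ℓ, ‖Hop ℓ‖ ^ 2) = σ at *
  have hm' : (0:ℝ) < m := by exact_mod_cast hm
  have hw := Real.pow_arith_mean_le_arith_mean_pow (Finset.univ : Finset (Fin m → Bool))
    (fun _ => (2^m : ℝ)⁻¹) (fun s => ‖∑ ℓ, rsign (s ℓ) • Hop ℓ‖) (fun _ _ => by positivity)
    (by simp) (fun _ _ => norm_nonneg _) (2*(p+1))
  rw [← Finset.mul_sum, ← Finset.mul_sum] at hw
  have h1 : ((2^m : ℝ)⁻¹ * ∑ s : Fin m → Bool, ‖∑ ℓ, rsign (s ℓ) • Hop ℓ‖)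
      ≤ Real.sqrt ((3 + 2 * Real.log r) * σ) := by
    refine le_of_pow_le_pow_left₀ (n := 2*(p+1)) (by omega) (Real.sqrt_nonneg _) (hw.trans ?_)
    rw [pow_mul (Real.sqrt _), Real.sq_sqrt (by positivity), inv_mul_le_iff₀ (by positivity)]
    refine hmom.trans ?_
    gcongr
    calc oddProd (p+1) * σ^p * (r * σ) = (oddProd (p+1) * r) * σ^(p+1) := by ring
      _ ≤ (3 + 2 * Real.log r)^(p+1) * σ^(p+1) := by gcongr
      _ = _ := by rw [mul_pow]
  have e1 : (∑ s : Fin m → Bool, ‖(m : ℝ)⁻¹ • ∑ ℓ, rsign (s ℓ) • Hop ℓ‖) / 2 ^ m =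
      (m:ℝ)⁻¹ * ((2^m : ℝ)⁻¹ * ∑ s : Fin m → Bool, ‖∑ ℓ, rsign (s ℓ) • Hop ℓ‖) := by
    simp only [norm_smul, ← Finset.mul_sum, norm_inv, Real.norm_natCast]
    rw [div_eq_inv_mul]; ring
  rw [e1, Real.sqrt_mul (by positivity), Real.sqrt_sq (by positivity)]
  rw [Real.sqrt_mul (by positivity)] at h1
  calc _ ≤ (m:ℝ)⁻¹ * (Real.sqrt (3 + 2 * Real.log r) * Real.sqrt σ) := by gcongr
    _ = _ := by ring
end

section
/- Moment recursion for Rademacher sums of self-adjoint Hilbert–Schmidt operators: let H be a separable Hilbert space, H_1,…,H_m self-adjoint Hilbert–Schmidt operators on H, ε_1,…,ε_m independent Rademacher random variables, and set H^ε=(1/m)Σ_{ℓ=1}^m ε_ℓH_ℓ and G=(1/m²)Σ_{ℓ=1}^m H_ℓ². Then for every integer p≥1, (H^ε)^{2p} is trace class and E_ε tr((H^ε)^{2p}) ≤ (2p−1)!! · ‖G‖^{p−1} · tr(G), where ‖·‖ is the operator norm and (2p−1)!!=1·3·⋯·(2p−1). -/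
open scoped RealInnerProductSpace

set_option linter.unusedSectionVars false

namespace RadMom

variable {H : Type*} [NormedAddCommGroup H] [InnerProductSpace ℝ H] [CompleteSpace H]
  {ι : Type*} (e : HilbertBasis ι ℝ H)

/-- Hilbert-Schmidt with respect to the basis `e`. -/
def HS (B : H →L[ℝ] H) : Prop := Summable fun i => ‖B (e i)‖ ^ 2

lemma mul_app (B C : H →L[ℝ] H) (v : H) : (B * C) v = B (C v) := rfl

/-- Hilbert-Schmidt inner product. -/
noncomputable def ip (B C : H →L[ℝ] H) : ℝ := ∑' i, ⟪B (e i), C (e i)⟫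

variable {e}

lemma HS.mul_left {B : H →L[ℝ] H} (hB : HS e B) (D : H →L[ℝ] H) : HS e (D * B) := by
  refine Summable.of_nonneg_of_le (fun i => by positivity) (fun i => ?_) (Summable.mul_left (‖D‖ ^ 2) hB)
  rw [← mul_pow]
  exact pow_le_pow_left₀ (norm_nonneg _) (D.le_opNorm _) 2

lemma summable_ip {B C : H →L[ℝ] H} (hB : HS e B) (hC : HS e C) :
    Summable fun i => ⟪B (e i), C (e i)⟫ := by
  refine Summable.of_norm_bounded (Summable.add hB hC) (fun i => ?_)
  have h := abs_real_inner_le_norm (B (e i)) (C (e i))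
  rw [Real.norm_eq_abs]
  nlinarith [sq_nonneg (‖B (e i)‖ - ‖C (e i)‖), sq_nonneg (‖B (e i)‖), sq_nonneg (‖C (e i)‖)]

lemma HS.add {B C : H →L[ℝ] H} (hB : HS e B) (hC : HS e C) : HS e (B + C) := by
  refine Summable.of_nonneg_of_le (fun i => by positivity) (fun i => ?_)
    ((Summable.add hB hC).mul_left 2)
  have h := norm_add_le (B (e i)) (C (e i))
  simp only [_root_.add_apply]
  nlinarith [sq_nonneg (‖B (e i)‖ - ‖C (e i)‖), norm_nonneg (B (e i) + C (e i))]

lemma HS.smul {B : H →L[ℝ] H} (hB : HS e B) (c : ℝ) : HS e (c • B) := by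
  refine (Summable.mul_left (c ^ 2) hB).congr (fun i => ?_)
  simp [norm_smul, mul_pow]

lemma HS.sub {B C : H →L[ℝ] H} (hB : HS e B) (hC : HS e C) : HS e (B - C) := by
  have := hB.add (hC.smul (-1))
  rwa [neg_one_smul, ← sub_eq_add_neg] at this

lemma HS.sum {κ : Type*} (s : Finset κ) {B : κ → H →L[ℝ] H} (hB : ∀ k ∈ s, HS e (B k)) :
    HS e (∑ k ∈ s, B k) := by
  classical
  induction s using Finset.induction_on with
  | empty => simp [HS]
  | insert a s ha ih =>
    rw [Finset.sum_insert ha]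
    exact (hB a (by simp)).add (ih fun k hk => hB k (by simp [hk]))

lemma norm_sq_hasSum (v : H) : HasSum (fun j => ⟪v, e j⟫ ^ 2) (‖v‖ ^ 2) := by
  have h := e.hasSum_inner_mul_inner v v
  rw [real_inner_self_eq_norm_sq] at h
  refine h.congr_fun ?_ |> id
  intro j
  rw [real_inner_comm v (e j), sq]

lemma star_aux {B : H →L[ℝ] H} (hB : HS e B) :
    HS e (star B) ∧ ip e (star B) (star B) = ip e B B := by
  have hF : Summable fun x : ι × ι => ⟪B (e x.1), e x.2⟫ ^ 2 := by
    rw [summable_prod_of_nonneg (fun x => by positivity)]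
    refine ⟨fun i => (norm_sq_hasSum (B (e i))).summable, ?_⟩
    refine Summable.congr hB (fun i => ?_)
    exact (norm_sq_hasSum (B (e i))).tsum_eq.symm
  have hst : ∀ i j, ⟪(star B) (e i), e j⟫ = ⟪B (e j), e i⟫ := by
    intro i j
    rw [ContinuousLinearMap.star_eq_adjoint, ContinuousLinearMap.adjoint_inner_left,
      real_inner_comm]
  have hF' := hF.prod_symm
  have h2 := (summable_prod_of_nonneg (fun x => by simp only [Pi.zero_apply]; positivity)).1 hF'
  have e1 : ∀ i, ∑' j, ⟪B (e j), e i⟫ ^ 2 = ‖(star B) (e i)‖ ^ 2 := by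
    intro i
    rw [← (norm_sq_hasSum (e := e) ((star B) (e i))).tsum_eq]
    simp only [hst]
  refine ⟨?_, ?_⟩
  · exact h2.2.congr (fun i => e1 i)
  · simp only [ip, real_inner_self_eq_norm_sq]
    simp only [← e1]
    rw [Summable.tsum_comm (f := fun i j => ⟪B (e i), e j⟫ ^ 2) hF]
    exact tsum_congr fun i => (norm_sq_hasSum (B (e i))).tsum_eq

lemma HS.star {B : H →L[ℝ] H} (hB : HS e B) : HS e (star B) := (star_aux hB).1

lemma HS.mul_right {B : H →L[ℝ] H} (hB : HS e B) (D : H →L[ℝ] H) : HS e (B * D) := by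
  have := (hB.star.mul_left (Star.star D)).star
  rwa [← star_mul, star_star] at this

lemma ip_comm (B C : H →L[ℝ] H) : ip e B C = ip e C B :=
  tsum_congr fun i => real_inner_comm _ _

lemma ip_add_right {B C D : H →L[ℝ] H} (hB : HS e B) (hC : HS e C) (hD : HS e D) :
    ip e B (C + D) = ip e B C + ip e B D := by
  unfold ip
  rw [← (summable_ip hB hC).tsum_add (summable_ip hB hD)]
  exact tsum_congr fun i => by simp [inner_add_right]

lemma ip_smul_right (c : ℝ) (B C : H →L[ℝ] H) :
    ip e B (c • C) = c * ip e B C := by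
  unfold ip
  rw [← tsum_mul_left]
  exact tsum_congr fun i => by simp [inner_smul_right]

lemma ip_sub_right {B C D : H →L[ℝ] H} (hB : HS e B) (hC : HS e C) (hD : HS e D) :
    ip e B (C - D) = ip e B C - ip e B D := by
  have := ip_add_right hB hC (hD.smul (-1))
  rw [ip_smul_right, neg_one_smul, ← sub_eq_add_neg] at this
  rw [this]; ring

lemma ip_sum_right {κ : Type*} (s : Finset κ) {B : H →L[ℝ] H} {C : κ → H →L[ℝ] H}
    (hB : HS e B) (hC : ∀ k, HS e (C k)) :
    ip e B (∑ k ∈ s, C k) = ∑ k ∈ s, ip e B (C k) := by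
  classical
  induction s using Finset.induction_on with
  | empty => simp [ip]
  | insert a s ha ih =>
    rw [Finset.sum_insert ha, Finset.sum_insert ha,
      ip_add_right hB (hC a) (HS.sum s fun k _ => hC k), ih]

lemma two_ip_le {B C : H →L[ℝ] H} (hB : HS e B) (hC : HS e C) :
    2 * ip e B C ≤ ip e B B + ip e C C := by
  unfold ip
  rw [← tsum_mul_left, ← (summable_ip hB hB).tsum_add (summable_ip hC hC)]
  refine Summable.tsum_le_tsum (fun i => ?_) ((summable_ip hB hC).mul_left 2)
    ((summable_ip hB hB).add (summable_ip hC hC))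
  have := real_inner_self_nonneg (x := B (e i) - C (e i))
  rw [inner_sub_left, inner_sub_right, inner_sub_right, real_inner_comm (B (e i)) (C (e i))] at this
  linarith

lemma ip_polar {B C : H →L[ℝ] H} (hB : HS e B) (hC : HS e C) :
    ip e (B + C) (B + C) = ip e B B + 2 * ip e B C + ip e C C := by
  rw [ip_add_right (hB.add hC) hB hC, ip_comm _ B, ip_comm _ C, ip_add_right hB hB hC,
    ip_add_right hC hB hC, ip_comm C B]
  ring

lemma ip_star {B C : H →L[ℝ] H} (hB : HS e B) (hC : HS e C) :
    ip e (star B) (star C) = ip e B C := by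
  have h1 := ip_polar hB hC
  have h2 := ip_polar hB.star hC.star
  rw [← star_add, (star_aux (hB.add hC)).2, (star_aux hB).2, (star_aux hC).2] at h2
  linarith

lemma ip_mul_left (D B C : H →L[ℝ] H) : ip e (D * B) C = ip e B (star D * C) := by
  refine tsum_congr fun i => ?_
  simp only [mul_app]
  rw [ContinuousLinearMap.star_eq_adjoint, ContinuousLinearMap.adjoint_inner_right]

lemma ip_mul_right {B C : H →L[ℝ] H} (hB : HS e B) (hC : HS e C) (D : H →L[ℝ] H) :
    ip e (B * D) C = ip e B (C * star D) := by
  rw [← ip_star (hB.mul_right D) hC, star_mul, ip_mul_left, ← ip_star hB (hC.mul_right _),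
    star_mul]

/-- midpoint-convexity sum bound -/
lemma conv_sum (f : ℕ → ℝ) (r : ℕ)
    (h1 : ∀ k, k + 1 ≤ r → 2 * f (2 * k + 1) ≤ f (2 * k) + f (2 * k + 2))
    (h2 : ∀ k, k + 2 ≤ r → 2 * f (2 * k + 2) ≤ f (2 * k) + f (2 * k + 4)) :
    ∑ q ∈ Finset.range (2 * r + 1), f q ≤ (2 * r + 1) / 2 * (f 0 + f (2 * r)) := by
  have L : ∀ k : ℕ, k + 1 ≤ r → (k + 1 : ℝ) * f (2 * k) ≤ f 0 + k * f (2 * k + 2) := by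
    intro k
    induction k with
    | zero => intro _; simp
    | succ k ih =>
      intro hk
      have a := ih (by omega)
      have b := h2 k (by omega)
      have c : 2 * (k + 1) = 2 * k + 2 := by ring
      rw [c]
      push_cast
      have d : 2 * k + 2 + 2 = 2 * k + 4 := by ring
      rw [d]
      have hk0 : (0 : ℝ) ≤ (k : ℝ) + 1 := by positivity
      nlinarith [mul_le_mul_of_nonneg_left b hk0]
  have M : ∀ j : ℕ, j ≤ r →
      ∑ q ∈ Finset.range (2 * j + 1), f q ≤ (2 * j + 1) / 2 * (f 0 + f (2 * j)) := by
    intro j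
    induction j with
    | zero => intro _; simp; linarith
    | succ j ih =>
      intro hj
      have a := ih (by omega)
      have b := L j hj
      have c := h1 j hj
      have d : 2 * (j + 1) = 2 * j + 2 := by ring
      rw [d, Finset.sum_range_succ, Finset.sum_range_succ]
      push_cast
      linarith
  exact M r le_rfl

lemma key_ineq {A X Y : H →L[ℝ] H} (hA : HS e A) (sA : IsSelfAdjoint A)
    (sX : IsSelfAdjoint X) (sY : IsSelfAdjoint Y) (r : ℕ) :
    ∑ q ∈ Finset.range (2 * r + 1), ip e A (X ^ q * A * Y ^ (2 * r - q)) ≤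
      (2 * r + 1) / 2 * (ip e (A * X ^ r) (A * X ^ r) + ip e (A * Y ^ r) (A * Y ^ r)) := by
  have hZ : ∀ a b, HS e (X ^ a * A * Y ^ b) := fun a b => (hA.mul_left _).mul_right _
  have hf : ∀ u v, u ≤ r → v ≤ r → ip e A (X ^ (u + v) * A * Y ^ (2 * r - (u + v))) =
      ip e (X ^ u * A * Y ^ (r - u)) (X ^ v * A * Y ^ (r - v)) := by
    intro u v hu hv
    rw [ip_mul_right (hA.mul_left _) (hZ _ _), ip_mul_left, (sX.pow u).star_eq,
      (sY.pow (r - u)).star_eq]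
    have : 2 * r - (u + v) = (r - v) + (r - u) := by omega
    rw [this, pow_add, pow_add]
    simp only [mul_assoc]
  have h0 : ip e A (X ^ 0 * A * Y ^ (2 * r - 0)) = ip e (A * Y ^ r) (A * Y ^ r) := by
    have := hf 0 0 (by omega) (by omega)
    simpa using this
  have hr : ip e A (X ^ (2 * r) * A * Y ^ (2 * r - 2 * r)) = ip e (A * X ^ r) (A * X ^ r) := by
    have := hf r r le_rfl le_rfl
    rw [← two_mul] at this
    rw [this, ← ip_star (hA.mul_right _) (hA.mul_right _), star_mul, sA.star_eq,
      (sX.pow r).star_eq]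
    simp
  have := conv_sum (fun q => ip e A (X ^ q * A * Y ^ (2 * r - q))) r ?_ ?_
  · simp only [h0, hr] at this
    linarith
  · intro k hk
    have a := hf k (k + 1) (by omega) hk
    have b := hf k k (by omega) (by omega)
    have c := hf (k + 1) (k + 1) hk hk
    rw [show k + (k + 1) = 2 * k + 1 by ring] at a
    rw [show k + k = 2 * k by ring] at b
    rw [show k + 1 + (k + 1) = 2 * k + 2 by ring] at c
    simp only [a, b, c]
    exact two_ip_le (hZ _ _) (hZ _ _)
  · intro k hk
    have a := hf k (k + 2) (by omega) hk
    have b := hf k k (by omega) (by omega)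
    have c := hf (k + 2) (k + 2) hk hk
    rw [show k + (k + 2) = 2 * k + 2 by ring] at a
    rw [show k + k = 2 * k by ring] at b
    rw [show k + 2 + (k + 2) = 2 * k + 4 by ring] at c
    simp only [a, b, c]
    exact two_ip_le (hZ _ _) (hZ _ _)

lemma tele (X Y : H →L[ℝ] H) (n : ℕ) :
    X ^ n - Y ^ n = ∑ q ∈ Finset.range n, X ^ q * (X - Y) * Y ^ (n - 1 - q) := by
  have h : ∀ q ∈ Finset.range n, X ^ q * (X - Y) * Y ^ (n - 1 - q) =
      X ^ (q + 1) * Y ^ (n - (q + 1)) - X ^ q * Y ^ (n - q) := by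
    intro q hq
    have hq' := Finset.mem_range.1 hq
    have h1 : n - q = (n - 1 - q) + 1 := by omega
    have h2 : n - (q + 1) = n - 1 - q := by omega
    rw [h2, h1, mul_sub, sub_mul, pow_succ, pow_succ']
    simp only [mul_assoc]
  rw [Finset.sum_congr rfl h, Finset.sum_range_sub (fun q => X ^ q * Y ^ (n - q))]
  simp

/-- The Rademacher sum. -/
noncomputable def XX {m : ℕ} (A : Fin m → H →L[ℝ] H) (s : Fin m → Bool) : H →L[ℝ] H :=
  ∑ l, rsign (s l) • A l

/-- Flip the sign at `l`. -/
def flip {m : ℕ} (l : Fin m) (s : Fin m → Bool) : Fin m → Bool := Function.update s l (!(s l))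

lemma flip_flip {m : ℕ} (l : Fin m) : Function.Involutive (flip l) := by
  intro s
  simp [flip]

lemma rsign_sq (b : Bool) : rsign b * rsign b = 1 := by cases b <;> simp [rsign]

lemma rsign_not (b : Bool) : rsign (!b) = - rsign b := by cases b <;> simp [rsign]

lemma XX_sub {m : ℕ} (A : Fin m → H →L[ℝ] H) (l : Fin m) (s : Fin m → Bool) :
    XX A s - XX A (flip l s) = (2 * rsign (s l)) • A l := by
  unfold XX
  rw [← Finset.sum_sub_distrib, Finset.sum_eq_single l]
  · simp only [flip, Function.update_self, rsign_not]
    rw [← sub_smul]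
    congr 1
    ring
  · intro b _ hb
    simp [flip, Function.update_of_ne hb]
  · simp

lemma XX_sa {m : ℕ} {A : Fin m → H →L[ℝ] H} (sA : ∀ l, IsSelfAdjoint (A l)) (s : Fin m → Bool) :
    IsSelfAdjoint (XX A s) := by
  unfold XX
  refine isSelfAdjoint_sum _ fun l _ => ?_
  exact IsSelfAdjoint.smul (IsSelfAdjoint.all _) (sA l)

lemma XX_HS {m : ℕ} {A : Fin m → H →L[ℝ] H} (hA : ∀ l, HS e (A l)) (s : Fin m → Bool) :
    HS e (XX A s) := HS.sum _ fun l _ => (hA l).smul _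

lemma HS.pow {B : H →L[ℝ] H} (hB : HS e B) (n : ℕ) : HS e (B ^ (n + 1)) := by
  rw [pow_succ]; exact hB.mul_left _

lemma one_coord {m : ℕ} {A : Fin m → H →L[ℝ] H} (hA : ∀ l, HS e (A l))
    (sA : ∀ l, IsSelfAdjoint (A l)) (l : Fin m) (r : ℕ) :
    ∑ s, rsign (s l) * ip e (A l) (XX A s ^ (2 * r + 1)) ≤
      (2 * r + 1) * ∑ s, ip e (A l * XX A s ^ r) (A l * XX A s ^ r) := by
  have hinv : ∀ f : (Fin m → Bool) → ℝ, ∑ s, f (flip l s) = ∑ s, f s := fun f =>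
    Equiv.sum_comp (flip_flip l).toPerm f
  have h1 : ∑ s, rsign (s l) * ip e (A l) (XX A (flip l s) ^ (2 * r + 1)) =
      - ∑ s, rsign (s l) * ip e (A l) (XX A s ^ (2 * r + 1)) := by
    rw [← hinv (fun s => rsign (s l) * ip e (A l) (XX A s ^ (2 * r + 1))),
      ← Finset.sum_neg_distrib]
    refine Finset.sum_congr rfl fun s _ => ?_
    simp [flip, rsign_not]
  have h2 : ∀ s, rsign (s l) * ip e (A l) (XX A s ^ (2 * r + 1)) -
      rsign (s l) * ip e (A l) (XX A (flip l s) ^ (2 * r + 1)) ≤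
      (2 * r + 1) * (ip e (A l * XX A s ^ r) (A l * XX A s ^ r) +
        ip e (A l * XX A (flip l s) ^ r) (A l * XX A (flip l s) ^ r)) := by
    intro s
    have k := key_ineq (hA l) (sA l) (XX_sa sA s) (XX_sa sA (flip l s)) r
    have t : ip e (A l) (XX A s ^ (2 * r + 1) - XX A (flip l s) ^ (2 * r + 1)) =
        2 * rsign (s l) * ∑ q ∈ Finset.range (2 * r + 1),
          ip e (A l) (XX A s ^ q * A l * XX A (flip l s) ^ (2 * r - q)) := by
      rw [tele, XX_sub, ← ip_sum_right _ (hA l) (fun q => ((hA l).mul_left _).mul_right _),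
        ← ip_smul_right, Finset.smul_sum]
      simp only [Nat.add_sub_cancel, mul_smul_comm, smul_mul_assoc]
    rw [← mul_sub, ← ip_sub_right (hA l) ((XX_HS hA s).pow _) ((XX_HS hA _).pow _), t]
    have := rsign_sq (s l)
    calc _ = 2 * (rsign (s l) * rsign (s l)) * ∑ q ∈ Finset.range (2 * r + 1),
          ip e (A l) (XX A s ^ q * A l * XX A (flip l s) ^ (2 * r - q)) := by ring
      _ ≤ _ := by rw [this]; linarith
  have h3 := Finset.sum_le_sum fun s (_ : s ∈ Finset.univ) => h2 s
  rw [Finset.sum_sub_distrib, h1, ← Finset.mul_sum, Finset.sum_add_distrib,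
    hinv (fun s => ip e (A l * XX A s ^ r) (A l * XX A s ^ r))] at h3
  linarith

lemma recursion {m : ℕ} {A : Fin m → H →L[ℝ] H} (hA : ∀ l, HS e (A l))
    (sA : ∀ l, IsSelfAdjoint (A l)) (r : ℕ) :
    ∑ s, ip e (XX A s ^ (r + 1)) (XX A s ^ (r + 1)) ≤
      (2 * r + 1) * ∑ s, ∑ l, ip e (A l * XX A s ^ r) (A l * XX A s ^ r) := by
  have h : ∀ s, ip e (XX A s ^ (r + 1)) (XX A s ^ (r + 1)) =
      ∑ l, rsign (s l) * ip e (A l) (XX A s ^ (2 * r + 1)) := by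
    intro s
    have hn := (XX_HS hA s).pow (2 * r)
    conv_lhs => rw [pow_succ, ip_mul_left, ((XX_sa sA s).pow r).star_eq, ← pow_succ, ← pow_add,
      show r + (r + 1) = 2 * r + 1 by ring, ip_comm]
    conv_lhs => arg 3; unfold XX
    rw [ip_sum_right _ hn (fun l => (hA l).smul _)]
    exact Finset.sum_congr rfl fun l _ => by rw [ip_smul_right, ip_comm]
  simp only [h]
  rw [Finset.sum_comm, Finset.sum_comm (s := Finset.univ (α := Fin m → Bool)) (t := Finset.univ (α := Fin m)) (f := fun s l => ip e (A l * XX A s ^ r) (A l * XX A s ^ r)), Finset.mul_sum]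
  exact Finset.sum_le_sum fun l _ => one_coord hA sA l r

lemma sum_inner {m : ℕ} {A : Fin m → H →L[ℝ] H} (sA : ∀ l, IsSelfAdjoint (A l)) (v : H) :
    ⟪(∑ l, A l ^ 2) v, v⟫ = ∑ l, ⟪A l v, A l v⟫ := by
  rw [_root_.sum_apply, _root_.sum_inner]
  refine Finset.sum_congr rfl fun l _ => ?_
  rw [sq, mul_app]
  have h := ContinuousLinearMap.adjoint_inner_left (A l) v (A l v)
  rwa [← ContinuousLinearMap.star_eq_adjoint, (sA l).star_eq] at h

lemma G_summable {m : ℕ} {A : Fin m → H →L[ℝ] H} (hA : ∀ l, HS e (A l))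
    (sA : ∀ l, IsSelfAdjoint (A l)) : Summable fun i => ⟪(∑ l, A l ^ 2) (e i), e i⟫ := by
  simp only [sum_inner sA]
  exact summable_sum fun l _ => summable_ip (hA l) (hA l)

lemma G_trace {m : ℕ} {A : Fin m → H →L[ℝ] H} (hA : ∀ l, HS e (A l))
    (sA : ∀ l, IsSelfAdjoint (A l)) :
    ∑ l, ip e (A l) (A l) = ∑' i, ⟪(∑ l, A l ^ 2) (e i), e i⟫ := by
  simp only [sum_inner sA]
  exact (Summable.tsum_finsetSum fun l _ => summable_ip (hA l) (hA l)).symm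

lemma G_bound {m : ℕ} {A : Fin m → H →L[ℝ] H} (hA : ∀ l, HS e (A l))
    (sA : ∀ l, IsSelfAdjoint (A l)) {B : H →L[ℝ] H} (hB : HS e B) :
    ∑ l, ip e (A l * B) (A l * B) ≤ ‖∑ l, A l ^ 2‖ * ip e B B := by
  have hs : ∀ l ∈ Finset.univ, Summable fun i => ⟪(A l * B) (e i), (A l * B) (e i)⟫ :=
    fun l _ => summable_ip (hB.mul_left _) (hB.mul_left _)
  unfold ip
  rw [← Summable.tsum_finsetSum hs, ← tsum_mul_left]
  refine Summable.tsum_le_tsum (fun i => ?_) (summable_sum hs) ((summable_ip hB hB).mul_left _)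
  simp only [mul_app]
  rw [← sum_inner sA, real_inner_self_eq_norm_sq]
  refine (real_inner_le_norm _ _).trans ?_
  rw [sq, ← mul_assoc]
  exact mul_le_mul_of_nonneg_right (ContinuousLinearMap.le_opNorm _ _) (norm_nonneg _)

lemma main {m : ℕ} {A : Fin m → H →L[ℝ] H} (hA : ∀ l, HS e (A l))
    (sA : ∀ l, IsSelfAdjoint (A l)) (r : ℕ) :
    ∑ s, ip e (XX A s ^ (r + 1)) (XX A s ^ (r + 1)) ≤
      2 ^ m * ((Nat.doubleFactorial (2 * r + 1) : ℝ) * ‖∑ l, A l ^ 2‖ ^ r *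
        ∑' i, ⟪(∑ l, A l ^ 2) (e i), e i⟫) := by
  induction r with
  | zero =>
    refine (recursion hA sA 0).trans (le_of_eq ?_)
    simp [G_trace hA sA]
  | succ r ih =>
    refine (recursion hA sA (r + 1)).trans ?_
    have h : ∑ s, ∑ l, ip e (A l * XX A s ^ (r + 1)) (A l * XX A s ^ (r + 1)) ≤
        ‖∑ l, A l ^ 2‖ * ∑ s, ip e (XX A s ^ (r + 1)) (XX A s ^ (r + 1)) := by
      rw [Finset.mul_sum]
      exact Finset.sum_le_sum fun s _ => G_bound hA sA ((XX_HS hA s).pow r)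
    have h' := h.trans (mul_le_mul_of_nonneg_left ih (norm_nonneg _))
    have hpos : (0 : ℝ) ≤ 2 * ((r + 1 : ℕ) : ℝ) + 1 := by positivity
    refine (mul_le_mul_of_nonneg_left h' hpos).trans (le_of_eq ?_)
    rw [show 2 * (r + 1) + 1 = (2 * r + 1) + 2 by ring, Nat.doubleFactorial_add_two]
    push_cast
    ring

end RadMom

/-- **Moment recursion for Rademacher sums of self-adjoint Hilbert–Schmidt operators**:
with `H^ε = (1/m) Σ_ℓ ε_ℓ H_ℓ` and `G = (1/m²) Σ_ℓ H_ℓ²`, for every integer `p ≥ 1`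
the operator `(H^ε)^{2p}` is trace class (here `tr((H^ε)^{2p}) = Σ_i ‖(H^ε)^p e_i‖²`,
since `H^ε` is self-adjoint) and `E_ε tr((H^ε)^{2p}) ≤ (2p−1)!! ‖G‖^{p−1} tr(G)`,
the expectation over the Rademacher signs being the average over all `2^m` sign
patterns. -/
theorem rademacher_sum_moment_recursion
    {H : Type*} [NormedAddCommGroup H] [InnerProductSpace ℝ H] [CompleteSpace H]
    {ι : Type*} [Countable ι] (e : HilbertBasis ι ℝ H)
    (m : ℕ) (hm : 0 < m) (Hop : Fin m → H →L[ℝ] H)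
    (hsa : ∀ ℓ, IsSelfAdjoint (Hop ℓ))
    (hHS : ∀ ℓ, Summable fun i => ‖Hop ℓ (e i)‖ ^ 2)
    (p : ℕ) (hp : 1 ≤ p) :
    (∀ s : Fin m → Bool,
      Summable fun i => ‖(((m : ℝ)⁻¹ • ∑ ℓ, rsign (s ℓ) • Hop ℓ) ^ p) (e i)‖ ^ 2) ∧
    (Summable fun i =>
      ⟪(((m : ℝ)⁻¹ ^ 2 • ∑ ℓ, Hop ℓ ^ 2) (e i) : H), e i⟫) ∧
    (∑ s : Fin m → Bool,
        ∑' i, ‖(((m : ℝ)⁻¹ • ∑ ℓ, rsign (s ℓ) • Hop ℓ) ^ p) (e i)‖ ^ 2) / 2 ^ m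
      ≤ (Nat.doubleFactorial (2 * p - 1) : ℝ)
          * ‖(m : ℝ)⁻¹ ^ 2 • ∑ ℓ, Hop ℓ ^ 2‖ ^ (p - 1)
          * ∑' i, ⟪(((m : ℝ)⁻¹ ^ 2 • ∑ ℓ, Hop ℓ ^ 2) (e i) : H), e i⟫ := by
  obtain ⟨r, rfl⟩ : ∃ r, p = r + 1 := ⟨p - 1, by omega⟩
  set A : Fin m → H →L[ℝ] H := fun l => (m : ℝ)⁻¹ • Hop l with hAdef
  have hA : ∀ l, RadMom.HS e (A l) := fun l => RadMom.HS.smul (hHS l) _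
  have sA : ∀ l, IsSelfAdjoint (A l) := fun l => IsSelfAdjoint.smul (IsSelfAdjoint.all _) (hsa l)
  have hX : ∀ s : Fin m → Bool,
      (m : ℝ)⁻¹ • ∑ ℓ, rsign (s ℓ) • Hop ℓ = RadMom.XX A s := by
    intro s
    rw [RadMom.XX, Finset.smul_sum]
    exact Finset.sum_congr rfl fun l _ => smul_comm _ _ _
  have hG : (m : ℝ)⁻¹ ^ 2 • ∑ ℓ, Hop ℓ ^ 2 = ∑ l, A l ^ 2 := by
    rw [Finset.smul_sum]
    exact Finset.sum_congr rfl fun l _ => (smul_pow _ _ _).symm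
  simp only [hX, hG]
  refine ⟨fun s => (RadMom.XX_HS hA s).pow r, RadMom.G_summable hA sA, ?_⟩
  have h := RadMom.main hA sA r
  rw [div_le_iff₀ (by positivity)]
  simp only [RadMom.ip, real_inner_self_eq_norm_sq] at h
  rw [show 2 * (r + 1) - 1 = 2 * r + 1 by omega, Nat.add_sub_cancel]
  linarith
end
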